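/- arXiv:2303.00305 — 2 statements merged into one kernel-verified Lean document; each statement's English description precedes it below -/
import Mathlib

section
/- Let n ≥ 2, let F be the free group on a_1,…,a_{2n}, let K and I be defined as above. Then I/K is elementary abelian of order 2^{(13n³−15n²+2n)/6}, F'I/I is elementary abelian of order 2^{(n³+n²)/2}, and the quotient F/I is a nilpotent group of nilpotency class exactly 3 and order 2^{(n³+n²+4n)/2}. -/
/-- The commutator `[g,h] = g⁻¹h⁻¹gh` (paper convention). -/
def gcomm {G : Type*} [Group G] (g h : G) : G := g⁻¹ * h⁻¹ * g * h

/-- The free group `F` on `2n` generators `a_1, …, a_{2n}`; the index set is split as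
`Fin n ⊕ Fin n`, where `Sum.inl i` indexes the generators in `A_0 = {a_1,…,a_n}` and
`Sum.inr i` indexes those in `B_0 = {a_{n+1},…,a_{2n}}`. -/
abbrev F2 (n : ℕ) := FreeGroup (Fin n ⊕ Fin n)

/-- A generator of `F` from `A_0`. -/
abbrev aA {n : ℕ} (i : Fin n) : F2 n := FreeGroup.of (Sum.inl i)

/-- A generator of `F` from `B_0`. -/
abbrev aB {n : ℕ} (i : Fin n) : F2 n := FreeGroup.of (Sum.inr i)

/-- An arbitrary generator of `F`. -/
abbrev aZ {n : ℕ} (z : Fin n ⊕ Fin n) : F2 n := FreeGroup.of z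

/-- The subgroup `K` of `F`: generated by `F_4` together with all `a_i²`, `[a_i,a_j]²`,
`[[a_i,a_j],a_k]²` and `[[a_i,a_j],a_i]` for `i,j,k ∈ {1,…,2n}` (Mathlib's
`lowerCentralSeries F 3` is `F_4`). -/
def K2 (n : ℕ) : Subgroup (F2 n) :=
  Subgroup.closure
    ((Subgroup.lowerCentralSeries (⊤ : Subgroup (F2 n)) 3 : Set (F2 n)) ∪
      ({w | ∃ z, w = aZ z ^ 2} ∪
       {w | ∃ z z', w = gcomm (aZ (n := n) z) (aZ z') ^ 2} ∪
       {w | ∃ z z' z'', w = gcomm (gcomm (aZ (n := n) z) (aZ z')) (aZ z'') ^ 2} ∪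
       {w | ∃ z z', w = gcomm (gcomm (aZ (n := n) z) (aZ z')) (aZ z)}))

/-- The subgroup `I` of `F`: generated by `K` together with all `[a,a']`, `[b,b']`,
`[[a,a'],c]`, `[[b,b'],c]`, `[[b,a],b']` for `a,a' ∈ A_0`, `b,b' ∈ B_0`,
`c ∈ A_0 ∪ B_0`. -/
def I2 (n : ℕ) : Subgroup (F2 n) :=
  Subgroup.closure
    ((K2 n : Set (F2 n)) ∪
      ({w | ∃ i j : Fin n, w = gcomm (aA i) (aA j)} ∪
       {w | ∃ i j : Fin n, w = gcomm (aB i) (aB j)} ∪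
       {w | ∃ (i j : Fin n) (z : Fin n ⊕ Fin n), w = gcomm (gcomm (aA i) (aA j)) (aZ z)} ∪
       {w | ∃ (i j : Fin n) (z : Fin n ⊕ Fin n), w = gcomm (gcomm (aB i) (aB j)) (aZ z)} ∪
       {w | ∃ (i j : Fin n) (k : Fin n), w = gcomm (gcomm (aB i) (aA k)) (aB j)}))


open scoped commutatorElement

/-- Unitriangular `4 × 4` matrices over `ZMod 2`, in coordinates. -/
@[ext] structure U4 where
  a : ZMod 2
  b : ZMod 2
  c : ZMod 2
  d : ZMod 2
  e : ZMod 2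
  f : ZMod 2

namespace U4

instance : One U4 := ⟨⟨0, 0, 0, 0, 0, 0⟩⟩
instance : Mul U4 := ⟨fun x y => ⟨x.a + y.a, x.b + y.b, x.c + y.c, x.d + x.a * y.b + y.d,
  x.e + x.b * y.c + y.e, x.f + x.a * y.e + x.d * y.c + y.f⟩⟩
instance : Inv U4 := ⟨fun x => ⟨-x.a, -x.b, -x.c, x.a * x.b - x.d, x.b * x.c - x.e,
  - x.f + x.a * x.e + x.d * x.c - x.a * x.b * x.c⟩⟩

lemma one_a : (1 : U4).a = 0 := rfl
lemma one_b : (1 : U4).b = 0 := rfl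
lemma one_c : (1 : U4).c = 0 := rfl
lemma one_d : (1 : U4).d = 0 := rfl
lemma one_e : (1 : U4).e = 0 := rfl
lemma one_f : (1 : U4).f = 0 := rfl
lemma mul_a (x y : U4) : (x * y).a = x.a + y.a := rfl
lemma mul_b (x y : U4) : (x * y).b = x.b + y.b := rfl
lemma mul_c (x y : U4) : (x * y).c = x.c + y.c := rfl
lemma mul_d (x y : U4) : (x * y).d = x.d + x.a * y.b + y.d := rfl
lemma mul_e (x y : U4) : (x * y).e = x.e + x.b * y.c + y.e := rfl
lemma mul_f (x y : U4) : (x * y).f = x.f + x.a * y.e + x.d * y.c + y.f := rfl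
lemma inv_a (x : U4) : (x⁻¹).a = -x.a := rfl
lemma inv_b (x : U4) : (x⁻¹).b = -x.b := rfl
lemma inv_c (x : U4) : (x⁻¹).c = -x.c := rfl
lemma inv_d (x : U4) : (x⁻¹).d = x.a * x.b - x.d := rfl
lemma inv_e (x : U4) : (x⁻¹).e = x.b * x.c - x.e := rfl
lemma inv_f (x : U4) : (x⁻¹).f =
  - x.f + x.a * x.e + x.d * x.c - x.a * x.b * x.c := rfl

instance : Group U4 := Group.ofLeftAxioms
  (fun x y z => by
    ext <;> simp only [mul_a, mul_b, mul_c, mul_d, mul_e, mul_f] <;> ring)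
  (fun x => by
    ext <;> simp only [mul_a, mul_b, mul_c, mul_d, mul_e, mul_f,
      one_a, one_b, one_c, one_d, one_e, one_f] <;> ring)
  (fun x => by
    ext <;> simp only [mul_a, mul_b, mul_c, mul_d, mul_e, mul_f,
      one_a, one_b, one_c, one_d, one_e, one_f,
      inv_a, inv_b, inv_c, inv_d, inv_e, inv_f] <;> ring)

lemma gcomm_a (x y : U4) : (gcomm x y).a = 0 := by
  simp only [gcomm, mul_a, inv_a]; ring
lemma gcomm_b (x y : U4) : (gcomm x y).b = 0 := by
  simp only [gcomm, mul_b, inv_b]; ring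
lemma gcomm_c (x y : U4) : (gcomm x y).c = 0 := by
  simp only [gcomm, mul_c, inv_c]; ring
lemma gcomm_d (x y : U4) : (gcomm x y).d = x.a * y.b - x.b * y.a := by
  simp only [gcomm, mul_d, mul_a, mul_b, inv_a, inv_b, inv_d]; ring
lemma gcomm_e (x y : U4) : (gcomm x y).e = x.b * y.c - x.c * y.b := by
  simp only [gcomm, mul_e, mul_c, mul_b, inv_c, inv_b, inv_e]; ring
lemma gcomm_f (x y : U4) (h1 : x.a = 0) (h2 : x.b = 0) (h3 : x.c = 0) :
    (gcomm x y).f = x.d * y.c - y.a * x.e := by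
  simp only [gcomm, mul_f, mul_e, mul_c, mul_b, inv_c, inv_b, inv_e, inv_f, mul_a, mul_d,
    inv_a, inv_d, h1, h2, h3]; ring

/-- Zero superdiagonal. -/
def L1 : Subgroup U4 where
  carrier := {x | x.a = 0 ∧ x.b = 0 ∧ x.c = 0}
  one_mem' := ⟨rfl, rfl, rfl⟩
  mul_mem' := by
    rintro x y ⟨h1, h2, h3⟩ ⟨k1, k2, k3⟩
    simp [mul_a, mul_b, mul_c, h1, h2, h3, k1, k2, k3]
  inv_mem' := by
    rintro x ⟨h1, h2, h3⟩
    simp [inv_a, inv_b, inv_c, h1, h2, h3]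

/-- Only the corner entry may be nonzero. -/
def L2 : Subgroup U4 where
  carrier := {x | x.a = 0 ∧ x.b = 0 ∧ x.c = 0 ∧ x.d = 0 ∧ x.e = 0}
  one_mem' := ⟨rfl, rfl, rfl, rfl, rfl⟩
  mul_mem' := by
    rintro x y ⟨h1, h2, h3, h4, h5⟩ ⟨k1, k2, k3, k4, k5⟩
    simp [mul_a, mul_b, mul_c, mul_d, mul_e, h1, h2, h3, k1, k2, k3, h4, h5, k4, k5]
  inv_mem' := by
    rintro x ⟨h1, h2, h3, h4, h5⟩
    simp [inv_a, inv_b, inv_c, inv_d, inv_e, h1, h2, h3, h4, h5]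

end U4

lemma lie_eq_gcomm {G : Type*} [Group G] (x y : G) : ⁅x, y⁆ = gcomm x⁻¹ y⁻¹ := by
  simp [gcomm, commutatorElement_def]

lemma gcomm_eq_lie {G : Type*} [Group G] (x y : G) : gcomm x y = ⁅x⁻¹, y⁻¹⁆ := by
  simp [gcomm, commutatorElement_def]

lemma map_gcomm {G H : Type*} [Group G] [Group H] (f : G →* H) (x y : G) :
    f (gcomm x y) = gcomm (f x) (f y) := by
  simp [gcomm]

namespace U4

lemma lcs1 : Subgroup.lowerCentralSeries (⊤ : Subgroup U4) 1 ≤ L1 := by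
  rw [Subgroup.lowerCentralSeries_succ, Subgroup.commutator_le]
  intro x _ y _
  rw [lie_eq_gcomm]
  exact ⟨gcomm_a _ _, gcomm_b _ _, gcomm_c _ _⟩

lemma gcomm_mem_L2 {x y : U4} (hx : x ∈ L1) : gcomm x y ∈ L2 := by
  obtain ⟨h1, h2, h3⟩ := hx
  refine ⟨gcomm_a _ _, gcomm_b _ _, gcomm_c _ _, ?_, ?_⟩
  · rw [gcomm_d, h1, h2]; ring
  · rw [gcomm_e, h2, h3]; ring

lemma lcs2 : Subgroup.lowerCentralSeries (⊤ : Subgroup U4) 2 ≤ L2 := by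
  rw [Subgroup.lowerCentralSeries_succ, Subgroup.commutator_le]
  intro x hx y _
  rw [lie_eq_gcomm]
  exact gcomm_mem_L2 (inv_mem (lcs1 hx))

lemma lcs3 : Subgroup.lowerCentralSeries (⊤ : Subgroup U4) 3 = ⊥ := by
  rw [eq_bot_iff, Subgroup.lowerCentralSeries_succ, Subgroup.commutator_le]
  intro x hx y _
  rw [lie_eq_gcomm, Subgroup.mem_bot]
  obtain ⟨h1, h2, h3, h4, h5⟩ := inv_mem (lcs2 hx)
  obtain ⟨_, _, _, k1, k2⟩ := gcomm_mem_L2 (y := y⁻¹) (x := x⁻¹) ⟨h1, h2, h3⟩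
  ext
  · exact gcomm_a _ _
  · exact gcomm_b _ _
  · exact gcomm_c _ _
  · exact k1
  · exact k2
  · rw [gcomm_f _ _ h1 h2 h3, h4, h5, one_f]; ring

lemma sq_of_L1 {x : U4} (hx : x ∈ L1) : x ^ 2 = 1 := by
  obtain ⟨h1, h2, h3⟩ := hx
  rw [pow_two]
  ext <;> simp [mul_a, mul_b, mul_c, mul_d, mul_e, mul_f, h1, h2, h3,
      one_a, one_b, one_c, one_d, one_e, one_f, CharTwo.add_self_eq_zero]

lemma gcomm_mem_L1 (x y : U4) : gcomm x y ∈ L1 := ⟨gcomm_a _ _, gcomm_b _ _, gcomm_c _ _⟩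

end U4

section rho
variable {n : ℕ}

/-- The representation of the free group given by three functions on the generators. -/
def rho (p q r : Fin n ⊕ Fin n → ZMod 2) : F2 n →* U4 :=
  FreeGroup.lift (fun z => ⟨p z, q z, r z, 0, 0, 0⟩)

lemma rho_aZ (p q r : Fin n ⊕ Fin n → ZMod 2) (z) :
    rho p q r (aZ z) = ⟨p z, q z, r z, 0, 0, 0⟩ := by
  simp [rho]

lemma F4_le_ker (φ : F2 n →* U4) :
    Subgroup.lowerCentralSeries (⊤ : Subgroup (F2 n)) 3 ≤ φ.ker := by
  intro x hx
  have h1 : φ x ∈ (Subgroup.lowerCentralSeries (⊤ : Subgroup (F2 n)) 3).map φ :=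
    Subgroup.mem_map_of_mem _ hx
  rw [Subgroup.map_lowerCentralSeries] at h1
  have h2 : ∀ k, Subgroup.lowerCentralSeries (Subgroup.map φ ⊤) k ≤
      Subgroup.lowerCentralSeries (⊤ : Subgroup U4) k := by
    intro k
    induction k with
    | zero => exact le_top
    | succ k ih => exact Subgroup.commutator_mono ih le_top
  have h3 := h2 3 h1
  rwa [U4.lcs3, Subgroup.mem_bot] at h3

lemma K_le_ker (p q r : Fin n ⊕ Fin n → ZMod 2) (hpq : ∀ z, p z * q z = 0)
    (hqr : ∀ z, q z * r z = 0) : K2 n ≤ (rho p q r).ker := by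
  rw [K2, Subgroup.closure_le]
  rintro x (hx | (((⟨z, rfl⟩ | ⟨z, z', rfl⟩) | ⟨z, z', z'', rfl⟩) | ⟨z, z', rfl⟩))
  · exact F4_le_ker _ hx
  · rw [SetLike.mem_coe, MonoidHom.mem_ker, map_pow, rho_aZ, pow_two]
    ext <;> simp [U4.mul_a, U4.mul_b, U4.mul_c, U4.mul_d, U4.mul_e, U4.mul_f, 
      U4.one_a, U4.one_b, U4.one_c, U4.one_d, U4.one_e, U4.one_f, CharTwo.add_self_eq_zero,
      hpq, hqr]
  · simp only [SetLike.mem_coe, MonoidHom.mem_ker, map_pow, map_gcomm]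
    exact U4.sq_of_L1 (U4.gcomm_mem_L1 _ _)
  · simp only [SetLike.mem_coe, MonoidHom.mem_ker, map_pow, map_gcomm]
    exact U4.sq_of_L1 (U4.gcomm_mem_L1 _ _)
  · simp only [SetLike.mem_coe, MonoidHom.mem_ker, map_gcomm]
    obtain ⟨h1, h2, h3, h4, h5⟩ := U4.gcomm_mem_L2 (y := rho p q r (aZ z))
      (U4.gcomm_mem_L1 (rho p q r (aZ z)) (rho p q r (aZ z')))
    ext
    · exact h1
    · exact h2
    · exact h3
    · exact h4
    · exact h5
    · rw [U4.gcomm_f _ _ (U4.gcomm_a _ _) (U4.gcomm_b _ _) (U4.gcomm_c _ _), U4.gcomm_d,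
        U4.gcomm_e, rho_aZ, rho_aZ, U4.one_f]
      simp only
      have := hpq z
      have := hqr z
      have h2 : (2 : ZMod 2) = 0 := rfl
      linear_combination (r z * p z * q z') * h2 - p z' * hqr z - r z' * hpq z

/-- The representations that kill `I`. -/
lemma I_le_ker (p q r : Fin n ⊕ Fin n → ZMod 2) (hp : ∀ i, p (.inr i) = 0)
    (hq : ∀ i, q (.inl i) = 0) (hr : ∀ i, r (.inr i) = 0) : I2 n ≤ (rho p q r).ker := by
  have hA : ∀ i j, gcomm (rho p q r (aA i)) (rho p q r (aA j)) = 1 := by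
    intro i j
    rw [rho_aZ, rho_aZ]
    ext <;> simp [gcomm, U4.mul_a, U4.mul_b, U4.mul_c, U4.mul_d, U4.mul_e, U4.mul_f,
      U4.inv_a, U4.inv_b, U4.inv_c, U4.inv_d, U4.inv_e, U4.inv_f,
      U4.one_a, U4.one_b, U4.one_c, U4.one_d, U4.one_e, U4.one_f, hq] <;> ring_nf <;>
      reduce_mod_char
  have hB : ∀ i j, gcomm (rho p q r (aB i)) (rho p q r (aB j)) = 1 := by
    intro i j
    rw [rho_aZ, rho_aZ]
    ext <;> simp [gcomm, U4.mul_a, U4.mul_b, U4.mul_c, U4.mul_d, U4.mul_e, U4.mul_f,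
      U4.inv_a, U4.inv_b, U4.inv_c, U4.inv_d, U4.inv_e, U4.inv_f,
      U4.one_a, U4.one_b, U4.one_c, U4.one_d, U4.one_e, U4.one_f, hp, hr] <;> ring_nf <;>
      reduce_mod_char
  have h1 : ∀ x : U4, gcomm 1 x = 1 := by intro x; simp [gcomm]
  rw [I2, Subgroup.closure_le]
  rintro x (hx | ((((⟨i, j, rfl⟩ | ⟨i, j, rfl⟩) | ⟨i, j, z, rfl⟩) | ⟨i, j, z, rfl⟩) |
    ⟨i, j, k, rfl⟩))
  · refine K_le_ker p q r ?_ ?_ hx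
    · rintro (i | i) <;> simp [hp, hq]
    · rintro (i | i) <;> simp [hr, hq]
  · simp only [SetLike.mem_coe, MonoidHom.mem_ker, map_gcomm, hA]
  · simp only [SetLike.mem_coe, MonoidHom.mem_ker, map_gcomm, hB]
  · simp only [SetLike.mem_coe, MonoidHom.mem_ker, map_gcomm, hA, h1]
  · simp only [SetLike.mem_coe, MonoidHom.mem_ker, map_gcomm, hB, h1]
  · simp only [SetLike.mem_coe, MonoidHom.mem_ker, map_gcomm]
    obtain ⟨h1, h2, h3, h4, h5⟩ := U4.gcomm_mem_L2 (y := rho p q r (aB j))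
      (U4.gcomm_mem_L1 (rho p q r (aB i)) (rho p q r (aA k)))
    ext
    · exact h1
    · exact h2
    · exact h3
    · exact h4
    · exact h5
    · rw [U4.gcomm_f _ _ (U4.gcomm_a _ _) (U4.gcomm_b _ _) (U4.gcomm_c _ _), U4.one_f,
        rho_aZ (z := Sum.inr j)]
      simp [hp, hr]

end rho

section basics
variable {G : Type*} [Group G]

lemma gcomm_mem_lcs {k : ℕ} {x : G} (hx : x ∈ Subgroup.lowerCentralSeries (⊤ : Subgroup G) k)
    (y : G) : gcomm x y ∈ Subgroup.lowerCentralSeries (⊤ : Subgroup G) (k + 1) := by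
  rw [gcomm_eq_lie, Subgroup.lowerCentralSeries_succ]
  exact Subgroup.commutator_mem_commutator (inv_mem hx) (Subgroup.mem_top _)

lemma gcomm_mem_commutator (x y : G) : gcomm x y ∈ commutator G := by
  rw [← Subgroup.top_lowerCentralSeries_one]
  exact gcomm_mem_lcs (k := 0) (Subgroup.mem_top _) y

lemma gcomm_sq_identity (x z : G) : z⁻¹ * x ^ 2 * z =
    x ^ 2 * (gcomm x z ^ 2 * gcomm (gcomm x z) x *
      gcomm (gcomm (gcomm x z) x) (gcomm x z)) := by
  simp only [gcomm, pow_two]; group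

end basics

section Knormal
variable {n : ℕ}

lemma F4_le_K : Subgroup.lowerCentralSeries (⊤ : Subgroup (F2 n)) 3 ≤ K2 n :=
  fun _ hx => Subgroup.subset_closure (Or.inl hx)

lemma K_sq (z) : aZ z ^ 2 ∈ K2 n :=
  Subgroup.subset_closure (Or.inr (Or.inl (Or.inl (Or.inl ⟨z, rfl⟩))))
lemma K_csq (z z') : gcomm (aZ z) (aZ z') ^ 2 ∈ K2 n :=
  Subgroup.subset_closure (Or.inr (Or.inl (Or.inl (Or.inr ⟨z, z', rfl⟩))))
lemma K_tsq (z z' z'') : gcomm (gcomm (aZ z) (aZ z')) (aZ z'') ^ 2 ∈ K2 n :=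
  Subgroup.subset_closure (Or.inr (Or.inl (Or.inr ⟨z, z', z'', rfl⟩)))
lemma K_rep (z z') : gcomm (gcomm (aZ z) (aZ z')) (aZ z) ∈ K2 n :=
  Subgroup.subset_closure (Or.inr (Or.inr ⟨z, z', rfl⟩))

lemma lcs_gcomm0 (x y : F2 n) : gcomm x y ∈ Subgroup.lowerCentralSeries (⊤ : Subgroup (F2 n)) 1 :=
  gcomm_mem_lcs (k := 0) (Subgroup.mem_top _) y

lemma conj_of_F3 {x : F2 n} (z : F2 n)
    (hx : x ∈ Subgroup.lowerCentralSeries (⊤ : Subgroup (F2 n)) 2) (hK : x ∈ K2 n) :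
    z⁻¹ * x * z ∈ K2 n := by
  have : z⁻¹ * x * z = x * gcomm x z := by simp only [gcomm]; group
  rw [this]
  exact mul_mem hK (F4_le_K (gcomm_mem_lcs hx z))

lemma K_conj {x : F2 n} (hx : x ∈ K2 n) (z) : (aZ z)⁻¹ * x * aZ z ∈ K2 n := by
  rw [K2] at hx
  induction hx using Subgroup.closure_induction with
  | one => simp
  | mul x y _ _ hx hy =>
    have : (aZ z)⁻¹ * (x * y) * aZ z = ((aZ z)⁻¹ * x * aZ z) * ((aZ z)⁻¹ * y * aZ z) := by group
    rw [this]; exact mul_mem hx hy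
  | inv x _ hx =>
    have : (aZ z)⁻¹ * x⁻¹ * aZ z = ((aZ z)⁻¹ * x * aZ z)⁻¹ := by group
    rw [this]; exact inv_mem hx
  | mem x hx =>
    rcases hx with hx | (((⟨u, rfl⟩ | ⟨u, v, rfl⟩) | ⟨u, v, w, rfl⟩) | ⟨u, v, rfl⟩)
    · have h3 : (Subgroup.lowerCentralSeries (⊤ : Subgroup (F2 n)) 3).Normal := inferInstance
      have := h3.conj_mem x hx (aZ z)⁻¹
      rw [inv_inv] at this
      exact F4_le_K this
    · rw [gcomm_sq_identity]
      refine mul_mem (K_sq u) (mul_mem (mul_mem (K_csq u z) (K_rep u z)) (F4_le_K ?_))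
      exact gcomm_mem_lcs (gcomm_mem_lcs (lcs_gcomm0 _ _) _) _
    · rw [gcomm_sq_identity]
      refine mul_mem (K_csq u v) (mul_mem (mul_mem (K_tsq u v z) (F4_le_K ?_)) (F4_le_K ?_))
      · exact gcomm_mem_lcs (gcomm_mem_lcs (lcs_gcomm0 _ _) _) _
      · refine Subgroup.lowerCentralSeries_antitone _ (show 3 ≤ 4 by norm_num) ?_
        exact gcomm_mem_lcs (gcomm_mem_lcs (gcomm_mem_lcs (lcs_gcomm0 _ _) _) _) _
    · exact conj_of_F3 _ (pow_mem (gcomm_mem_lcs (lcs_gcomm0 _ _) _) 2) (K_tsq u v w)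
    · exact conj_of_F3 _ (gcomm_mem_lcs (lcs_gcomm0 _ _) _) (K_rep u v)

instance K_normal : (K2 n).Normal := by
  refine ⟨fun x hx g => ?_⟩
  revert x
  induction g using FreeGroup.induction_on with
  | C1 => intro x hx; simpa using hx
  | of z =>
    intro x hx
    have h : aZ z * x * (aZ z)⁻¹ = aZ z ^ 2 * ((aZ z)⁻¹ * x * aZ z) * (aZ z ^ 2)⁻¹ := by group
    have h' := mul_mem (mul_mem (K_sq z) (K_conj hx z)) (inv_mem (K_sq z))
    rw [← h] at h'
    exact h'
  | inv_of z _ =>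
    intro x hx
    have := K_conj hx z
    simpa using this
  | mul g h hg hh =>
    intro x hx
    have : g * h * x * (g * h)⁻¹ = g * (h * x * h⁻¹) * g⁻¹ := by group
    rw [this]
    exact hg _ (hh _ hx)

end Knormal

section basis
variable {Z : Type*}

/-- Index type of the basic commutators of weight two and three (without repetitions). -/
abbrev TT (rk : Z → ℕ) := {p : Z × Z // rk p.1 < rk p.2} ⊕
  {p : Z × Z × Z // rk p.1 < rk p.2.1 ∧ rk p.1 < rk p.2.2 ∧ p.2.1 ≠ p.2.2}

/-- The basic commutators. -/
def bas {G : Type*} [Group G] (rk : Z → ℕ) (g : Z → G) : TT rk → G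
  | .inl p => gcomm (g p.1.1) (g p.1.2)
  | .inr p => gcomm (gcomm (g p.1.1) (g p.1.2.1)) (g p.1.2.2)

lemma map_bas {G H : Type*} [Group G] [Group H] (f : G →* H) (rk : Z → ℕ) (g : Z → G) (t) :
    f (bas rk g t) = bas rk (fun z => f (g z)) t := by
  rcases t with t | t <;> simp [bas, map_gcomm]

variable {G : Type*} [Group G]

lemma lcs3_central (h4 : Subgroup.lowerCentralSeries (⊤ : Subgroup G) 3 = ⊥) (x y z w : G) :
    gcomm (gcomm x y) z * w = w * gcomm (gcomm x y) z := by
  have h : gcomm (gcomm (gcomm x y) z) w ∈ Subgroup.lowerCentralSeries (⊤ : Subgroup G) 3 :=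
    gcomm_mem_lcs (gcomm_mem_lcs (gcomm_mem_lcs (k := 0) (Subgroup.mem_top _) y) z) w
  rw [h4, Subgroup.mem_bot] at h
  generalize gcomm (gcomm x y) z = c at h ⊢
  have : c * w = w * c * gcomm c w := by simp only [gcomm]; group
  rw [this, h, mul_one]

lemma derived_comm (h4 : Subgroup.lowerCentralSeries (⊤ : Subgroup G) 3 = ⊥) {x y : G}
    (hx : x ∈ commutator G) (hy : y ∈ commutator G) : x * y = y * x := by
  have h1 : ⁅⁅commutator G, (⊤ : Subgroup G)⁆, (⊤ : Subgroup G)⁆ = ⊥ := h4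
  have h2 : ⁅⁅(⊤ : Subgroup G), (⊤ : Subgroup G)⁆, commutator G⁆ = ⊥ := by
    apply Subgroup.commutator_commutator_eq_bot_of_rotate
    · rw [Subgroup.commutator_comm ⊤]; exact h1
    · exact h1
  have h3 : ⁅x, y⁆ ∈ ⁅⁅(⊤ : Subgroup G), (⊤ : Subgroup G)⁆, commutator G⁆ :=
    Subgroup.commutator_mem_commutator hx hy
  rw [h2, Subgroup.mem_bot] at h3
  exact commutatorElement_eq_one_iff_mul_comm.1 h3

lemma gcomm_swap (x y : G) : gcomm y x = (gcomm x y)⁻¹ := by simp only [gcomm]; group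

lemma gcomm_inv_left (h4 : Subgroup.lowerCentralSeries (⊤ : Subgroup G) 3 = ⊥) (x y z : G) :
    gcomm (gcomm x y)⁻¹ z = (gcomm (gcomm x y) z)⁻¹ := by
  have h := lcs3_central h4 x y z (gcomm x y)
  generalize gcomm x y = c at h ⊢
  have h1 : gcomm c⁻¹ z = c * (gcomm c z)⁻¹ * c⁻¹ := by simp only [gcomm]; group
  rw [h1]
  generalize gcomm c z = d at h ⊢
  rw [mul_inv_eq_iff_eq_mul, eq_inv_mul_iff_mul_eq, ← mul_assoc, h]
  group

lemma jacobi (h4 : Subgroup.lowerCentralSeries (⊤ : Subgroup G) 3 = ⊥) {x y z : G}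
    (hx : x ^ 2 = 1) (hy : y ^ 2 = 1) (hz : z ^ 2 = 1) :
    gcomm (gcomm x y) z * gcomm (gcomm z x) y * gcomm (gcomm y z) x = 1 := by
  have inv' : ∀ {u : G}, u ^ 2 = 1 → u⁻¹ = u := by
    intro u hu; rw [inv_eq_iff_mul_eq_one, ← pow_two, hu]
  have key : ∀ {u v w : G}, w ^ 2 = 1 → u ^ 2 = 1 → v ^ 2 = 1 →
      u * ⁅⁅u⁻¹, v⁆, w⁆ * u⁻¹ = (gcomm (gcomm u v) w)⁻¹ := by
    intro u v w hw hu hv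
    have h1 : ⁅u⁻¹, v⁆ = gcomm u v := by rw [lie_eq_gcomm, inv_inv, inv' hv]
    have h2 : ⁅gcomm u v, w⁆ = (gcomm (gcomm u v) w)⁻¹ := by
      rw [lie_eq_gcomm, inv' hw, gcomm_inv_left h4]
    rw [h1, h2]
    have h := lcs3_central h4 u v w u
    generalize gcomm (gcomm u v) w = d at h ⊢
    rw [mul_inv_eq_iff_eq_mul, eq_inv_mul_iff_mul_eq, ← mul_assoc, h]
    group
  have A := key hz hx hy
  have B := key hy hz hx
  have C := key hx hy hz
  have H : x * ⁅⁅x⁻¹, y⁆, z⁆ * x⁻¹ * (z * ⁅⁅z⁻¹, x⁆, y⁆ * z⁻¹) * (y * ⁅⁅y⁻¹, z⁆, x⁆ * y⁻¹) = 1 := by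
    simp only [commutatorElement_def]; group
  rw [A, B, C, ← mul_inv_rev, ← mul_inv_rev, inv_eq_one] at H
  rw [lcs3_central h4 x y z, ← lcs3_central h4 y z x, H]

/-- The derived subgroup is generated by the basic commutators. -/
lemma derived_le_closure (rk : Z → ℕ) (hrk : Function.Injective rk) (g : Z → G)
    (hgen : Subgroup.closure (Set.range g) = ⊤)
    (h4 : Subgroup.lowerCentralSeries (⊤ : Subgroup G) 3 = ⊥)
    (h2 : ∀ z, g z ^ 2 = 1) (hr : ∀ z z', gcomm (gcomm (g z) (g z')) (g z) = 1) :
    commutator G ≤ Subgroup.closure (Set.range (bas rk g)) := by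
  set S := Subgroup.closure (Set.range (bas rk g)) with hS
  have e2 : ∀ u v, rk u < rk v → gcomm (g u) (g v) ∈ S := fun u v h =>
    Subgroup.subset_closure ⟨.inl ⟨(u, v), h⟩, rfl⟩
  have e3 : ∀ u v w, rk u < rk v → rk u < rk w → v ≠ w →
      gcomm (gcomm (g u) (g v)) (g w) ∈ S := fun u v w h h' h'' =>
    Subgroup.subset_closure ⟨.inr ⟨(u, v, w), h, h', h''⟩, rfl⟩
  have c2 : ∀ u v, gcomm (g u) (g v) ∈ S := by
    intro u v
    rcases lt_trichotomy (rk u) (rk v) with h | h | h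
    · exact e2 u v h
    · rw [hrk h]; simp [gcomm]
    · rw [gcomm_swap]; exact inv_mem (e2 _ _ h)
  have sw : ∀ u v w, gcomm (gcomm (g v) (g u)) (g w) = (gcomm (gcomm (g u) (g v)) (g w))⁻¹ := by
    intro u v w
    rw [gcomm_swap (g u) (g v), gcomm_inv_left h4]
  have c3a : ∀ u v w, rk u < rk v → rk u < rk w → gcomm (gcomm (g u) (g v)) (g w) ∈ S := by
    intro u v w h h'
    by_cases hvw : v = w
    · subst hvw
      rw [sw, hr]; simp
    · exact e3 u v w h h' hvw
  have c3 : ∀ u v w, gcomm (gcomm (g u) (g v)) (g w) ∈ S := by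
    intro u v w
    by_cases huv : u = v
    · subst huv; simp [gcomm]
    by_cases huw : u = w
    · subst huw; rw [hr]; exact one_mem _
    by_cases hvw : v = w
    · subst hvw; rw [sw, hr]; simp
    have n1 : rk u ≠ rk v := fun h => huv (hrk h)
    have n2 : rk u ≠ rk w := fun h => huw (hrk h)
    have n3 : rk v ≠ rk w := fun h => hvw (hrk h)
    by_cases m1 : rk u < rk v ∧ rk u < rk w
    · exact c3a u v w m1.1 m1.2
    by_cases m2 : rk v < rk u ∧ rk v < rk w
    · rw [sw]; exact inv_mem (c3a v u w m2.1 m2.2)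
    have m3 : rk w < rk u ∧ rk w < rk v := by omega
    have J := jacobi h4 (h2 u) (h2 v) (h2 w)
    rw [mul_assoc, mul_eq_one_iff_eq_inv] at J
    rw [J]
    refine inv_mem (mul_mem (c3a w u v m3.1 m3.2) ?_)
    rw [sw]
    exact inv_mem (c3a w v u m3.2 m3.1)
  have conjG : ∀ z x, x ∈ S → g z * x * (g z)⁻¹ ∈ S := by
    intro z x hx
    have hz : (g z)⁻¹ = g z := by rw [inv_eq_iff_mul_eq_one, ← pow_two, h2]
    induction hx using Subgroup.closure_induction with
    | one => simp
    | mul x y _ _ hx hy =>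
      have : g z * (x * y) * (g z)⁻¹ = (g z * x * (g z)⁻¹) * (g z * y * (g z)⁻¹) := by group
      rw [this]; exact mul_mem hx hy
    | inv x _ hx =>
      have : g z * x⁻¹ * (g z)⁻¹ = (g z * x * (g z)⁻¹)⁻¹ := by group
      rw [this]; exact inv_mem hx
    | mem x hx =>
      obtain ⟨t | t, rfl⟩ := hx
      · simp only [bas]
        have : ∀ c : G, g z * c * (g z)⁻¹ = c * gcomm c (g z) := by
          intro c
          conv_lhs => rw [← hz]
          simp only [gcomm]; group
        rw [this]
        exact mul_mem (c2 _ _) (c3 _ _ _)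
      · simp only [bas]
        rw [← lcs3_central h4, mul_inv_cancel_right]
        exact c3 _ _ _
  have hN : S.Normal := by
    refine ⟨fun x hx y => ?_⟩
    have hy : y ∈ Subgroup.closure (Set.range g) := by rw [hgen]; trivial
    revert x
    induction hy using Subgroup.closure_induction'' with
    | one => intro x hx; simpa using hx
    | mem y hy =>
      obtain ⟨z, rfl⟩ := hy
      exact fun x hx => conjG z x hx
    | inv_mem y hy =>
      obtain ⟨z, rfl⟩ := hy
      have hz : (g z)⁻¹ = g z := by rw [inv_eq_iff_mul_eq_one, ← pow_two, h2]
      intro x hx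
      rw [hz]
      have := conjG z x hx
      rw [hz] at this
      rwa [hz]
    | mul y y' _ _ h h' =>
      intro x hx
      have : y * y' * x * (y * y')⁻¹ = y * (y' * x * y'⁻¹) * y⁻¹ := by group
      rw [this]
      exact h _ (h' _ hx)
  -- commutators modulo `S`
  have step1 : ∀ z x, gcomm x (g z) ∈ S := by
    intro z x
    have hx : x ∈ Subgroup.closure (Set.range g) := by rw [hgen]; trivial
    induction hx using Subgroup.closure_induction with
    | one => simp [gcomm]
    | mem y hy => obtain ⟨u, rfl⟩ := hy; exact c2 _ _
    | mul x y _ _ hx hy =>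
      have : gcomm (x * y) (g z) = (y⁻¹ * gcomm x (g z) * y⁻¹⁻¹) * gcomm y (g z) := by
        simp only [gcomm]; group
      rw [this]
      exact mul_mem (hN.conj_mem _ hx _) hy
    | inv x _ hx =>
      have : gcomm x⁻¹ (g z) = x * (gcomm x (g z))⁻¹ * x⁻¹ := by
        simp only [gcomm]; group
      rw [this]
      exact hN.conj_mem _ (inv_mem hx) _
  have step2 : ∀ y x, gcomm x y ∈ S := by
    intro y x
    have hy : y ∈ Subgroup.closure (Set.range g) := by rw [hgen]; trivial
    induction hy using Subgroup.closure_induction with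
    | one => simp [gcomm]
    | mem y hy => obtain ⟨u, rfl⟩ := hy; exact step1 _ _
    | mul u y _ _ hx hy =>
      have : gcomm x (u * y) = gcomm x y * (y⁻¹ * gcomm x u * y⁻¹⁻¹) := by
        simp only [gcomm]; group
      rw [this]
      exact mul_mem hy (hN.conj_mem _ hx _)
    | inv y _ hx =>
      have : gcomm x y⁻¹ = y * (gcomm x y)⁻¹ * y⁻¹ := by
        simp only [gcomm]; group
      rw [this]
      exact hN.conj_mem _ (inv_mem hx) _
  rw [commutator_def, Subgroup.commutator_le]
  intro x _ y _
  rw [lie_eq_gcomm]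
  exact step2 _ _

end basis

/-- Counting lemma: an elementary abelian section with a dual basis. -/
lemma relIndex_of_dual {G : Type*} [Group G] {N H : Subgroup G}
    (hsq : ∀ h ∈ H, h * h ∈ N) (hcm : ∀ g ∈ H, ∀ h ∈ H, gcomm g h ∈ N)
    {T : Type*} [Fintype T] [DecidableEq T] (e : T → G) (he : ∀ t, e t ∈ H)
    (hspan : H ≤ Subgroup.closure (Set.range e) ⊔ N) (hNH : N ≤ H)
    (c : T → G → ZMod 2) (hadd : ∀ t, ∀ g ∈ H, ∀ h ∈ H, c t (g * h) = c t g + c t h)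
    (hN : ∀ t, ∀ g ∈ N, c t g = 0) (hce : ∀ s t, c s (e t) = if s = t then 1 else 0) :
    N.relIndex H = 2 ^ Fintype.card T := by
  let M := N.subgroupOf H
  have hMn : M.Normal := by
    refine ⟨fun x hx y => ?_⟩
    have h1 : (y : G) * x * (y : G)⁻¹ = (x : G) * gcomm (x : G) (y : G)⁻¹ := by
      simp only [gcomm]; group
    change ((y * x * y⁻¹ : H) : G) ∈ N
    push_cast
    rw [h1]
    exact mul_mem hx (hcm _ x.2 _ (inv_mem y.2))
  let A := H ⧸ M
  have hcomm : ∀ x y : A, x * y = y * x := by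
    intro x y
    induction x using QuotientGroup.induction_on with | _ x =>
    induction y using QuotientGroup.induction_on with | _ y =>
    rw [← QuotientGroup.mk_mul, ← QuotientGroup.mk_mul, QuotientGroup.eq]
    change (((x * y)⁻¹ * (y * x) : H) : G) ∈ N
    have := hcm _ y.2 _ x.2
    simp only [gcomm] at this
    push_cast
    convert this using 1
    group
  letI : CommGroup A := { (inferInstance : Group A) with mul_comm := hcomm }
  have hAsq : ∀ x : A, x ^ 2 = 1 := by
    intro x
    induction x using QuotientGroup.induction_on with | _ x =>
    rw [pow_two, ← QuotientGroup.mk_mul, QuotientGroup.eq_one_iff]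
    exact hsq _ x.2
  let cH : H →* Multiplicative (T → ZMod 2) :=
    MonoidHom.mk' (fun h => Multiplicative.ofAdd (fun t => c t h)) (by
      intro x y
      rw [← ofAdd_add]
      congr 1
      funext t
      exact hadd t _ x.2 _ y.2)
  let cA : A →* Multiplicative (T → ZMod 2) := QuotientGroup.lift M cH (by
    intro x hx
    change Multiplicative.ofAdd (fun t => c t (x : G)) = 1
    rw [← ofAdd_zero]
    congr 1
    funext t
    exact hN t _ hx)
  let eA : T → A := fun t => QuotientGroup.mk ⟨e t, he t⟩
  have hpow : ∀ (x : A) (a b : ZMod 2), x ^ (a + b).val = x ^ a.val * x ^ b.val := by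
    intro x a b
    rw [← pow_add, ZMod.val_add]
    conv_rhs => rw [← Nat.div_add_mod (a.val + b.val) 2, pow_add, pow_mul, hAsq, one_pow, one_mul]
  let psi : Multiplicative (T → ZMod 2) →* A :=
    MonoidHom.mk' (fun f => ∏ t, eA t ^ (f.toAdd t).val) (by
      intro x y
      rw [← Finset.prod_mul_distrib]
      refine Finset.prod_congr rfl fun t _ => ?_
      rw [← hpow]; rfl)
  have hcA : ∀ t, cA (eA t) = Multiplicative.ofAdd (fun s => if s = t then 1 else 0) := by
    intro t
    change Multiplicative.ofAdd (fun s => c s (e t)) = _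
    congr 1
    funext s
    exact hce s t
  have hpsi : ∀ t, psi (Multiplicative.ofAdd (fun s => if s = t then 1 else 0)) = eA t := by
    intro t
    change ∏ s, eA s ^ (if s = t then (1 : ZMod 2) else 0).val = eA t
    rw [Finset.prod_eq_single t]
    · simp [ZMod.val_one]
    · intro s _ hs; simp [hs]
    · simp
  have hgenA : Subgroup.closure (Set.range eA) = ⊤ := by
    rw [eq_top_iff]
    intro x _
    induction x using QuotientGroup.induction_on with | _ x =>
    have key : ∀ y ∈ Subgroup.closure (Set.range e) ⊔ N, ∀ hy : y ∈ H,
        (QuotientGroup.mk (⟨y, hy⟩ : H) : A) ∈ Subgroup.closure (Set.range eA) := by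
      let Q : Subgroup G := ((Subgroup.closure (Set.range eA)).comap
        (QuotientGroup.mk' M)).map H.subtype
      have hQ : Subgroup.closure (Set.range e) ⊔ N ≤ Q := by
        refine sup_le ((Subgroup.closure_le _).2 ?_) ?_
        · rintro _ ⟨t, rfl⟩
          exact ⟨⟨e t, he t⟩, Subgroup.subset_closure ⟨t, rfl⟩, rfl⟩
        · intro x hx
          refine ⟨⟨x, hNH hx⟩, ?_, rfl⟩
          have : (QuotientGroup.mk' M) ⟨x, hNH hx⟩ = 1 := (QuotientGroup.eq_one_iff _).2 hx
          simp only [SetLike.mem_coe, Subgroup.mem_comap, this, one_mem]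
      intro y hy hyH
      obtain ⟨w, hw, rfl⟩ := hQ hy
      exact hw
    exact key x.1 (hspan x.2) x.2
  have hinv : ∀ x, psi (cA x) = x := by
    intro x
    have hx : x ∈ Subgroup.closure (Set.range eA) := by rw [hgenA]; trivial
    refine MonoidHom.eqOn_closure (f := psi.comp cA) (g := MonoidHom.id A) ?_ hx
    rintro _ ⟨t, rfl⟩
    simp only [MonoidHom.comp_apply, MonoidHom.id_apply, hcA, hpsi]
  have hinv' : ∀ f, cA (psi f) = f := by
    intro f
    change cA (∏ t, eA t ^ (f.toAdd t).val) = f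
    rw [map_prod]
    simp only [map_pow, hcA]
    apply Multiplicative.toAdd.injective
    rw [toAdd_prod]
    funext s
    simp [Finset.sum_apply, toAdd_pow]
    rw [ZMod.cast_eq_val, Pi.natCast_apply, ZMod.natCast_zmod_val]
  have hcard : Nat.card A = Nat.card (Multiplicative (T → ZMod 2)) :=
    Nat.card_congr ⟨cA, psi, hinv, hinv'⟩
  have : N.relIndex H = Nat.card A := rfl
  rw [this, hcard]
  simp [Nat.card_eq_fintype_card]

section counting

lemma card_pairs (m : ℕ) : Fintype.card {p : Fin m × Fin m // p.1 < p.2} * 2 + m = m * m := by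
  have h : Fintype.card {p : Fin m × Fin m // p.1 < p.2} = ∑ k ∈ Finset.range m, k := by
    rw [Fintype.card_subtype, Finset.card_filter, Fintype.sum_prod_type, ← Finset.sum_range_reflect,
      Finset.sum_range]
    refine Finset.sum_congr rfl fun x _ => ?_
    rw [← Finset.card_filter, Finset.filter_lt_eq_Ioi, Fin.card_Ioi]
  rw [h]
  clear h
  induction m with
  | zero => rfl
  | succ m ih => rw [Finset.sum_range_succ]; linarith

lemma card_triples (m : ℕ) : Fintype.card {p : Fin m × Fin m × Fin m //
      p.1 < p.2.1 ∧ p.1 < p.2.2 ∧ p.2.1 ≠ p.2.2} * 3 + 3 * (m * m) = m * m * m + 2 * m := by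
  have h : Fintype.card {p : Fin m × Fin m × Fin m //
      p.1 < p.2.1 ∧ p.1 < p.2.2 ∧ p.2.1 ≠ p.2.2} = ∑ k ∈ Finset.range m, (k * k - k) := by
    rw [Fintype.card_subtype, Finset.card_filter, Fintype.sum_prod_type, ← Finset.sum_range_reflect,
      Finset.sum_range]
    refine Finset.sum_congr rfl fun x _ => ?_
    rw [← Finset.card_filter, ← Fin.card_Ioi, ← Finset.offDiag_card]
    congr 1
    ext ⟨y, z⟩
    simp [Finset.mem_offDiag]
  rw [h]
  clear h
  induction m with
  | zero => rfl
  | succ m ih =>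
    rw [Finset.sum_range_succ]
    have : m ≤ m * m := Nat.le_mul_self m
    obtain ⟨d, hd⟩ := Nat.exists_eq_add_of_le this
    have : m * m - m = d := by omega
    rw [this]
    nlinarith

end counting

section final
variable {n : ℕ}

/-- Rank of a generator. -/
def rk : Fin n ⊕ Fin n → ℕ := fun z => (finSumFinEquiv z : Fin (n + n))

lemma rk_inj : Function.Injective (rk (n := n)) :=
  fun _ _ h => finSumFinEquiv.injective (Fin.ext h)

lemma rk_inl (i : Fin n) : rk (Sum.inl i : Fin n ⊕ Fin n) = i := by simp [rk]
lemma rk_inr (i : Fin n) : rk (Sum.inr i : Fin n ⊕ Fin n) = n + i := by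
  simp [rk]
  omega

lemma card_T2 : Fintype.card {p : (Fin n ⊕ Fin n) × (Fin n ⊕ Fin n) // rk p.1 < rk p.2} =
    Fintype.card {p : Fin (n + n) × Fin (n + n) // p.1 < p.2} :=
  Fintype.card_congr ((Equiv.prodCongr finSumFinEquiv finSumFinEquiv).subtypeEquiv
    (fun _ => Iff.rfl))

lemma card_T3 : Fintype.card {p : (Fin n ⊕ Fin n) × (Fin n ⊕ Fin n) × (Fin n ⊕ Fin n) //
      rk p.1 < rk p.2.1 ∧ rk p.1 < rk p.2.2 ∧ p.2.1 ≠ p.2.2} =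
    Fintype.card {p : Fin (n + n) × Fin (n + n) × Fin (n + n) //
      p.1 < p.2.1 ∧ p.1 < p.2.2 ∧ p.2.1 ≠ p.2.2} :=
  Fintype.card_congr ((Equiv.prodCongr finSumFinEquiv
    (Equiv.prodCongr finSumFinEquiv finSumFinEquiv)).subtypeEquiv
    (fun p => and_congr Iff.rfl (and_congr Iff.rfl (finSumFinEquiv.injective.ne_iff.symm))))

/-- The product of the derived subgroup and the subgroup K. -/
def HH (n : ℕ) : Subgroup (F2 n) := commutator (F2 n) ⊔ K2 n

lemma K_le_H : K2 n ≤ HH n := le_sup_right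

/-- Generators of the quotient `F/K`. -/
def gq (z : Fin n ⊕ Fin n) : F2 n ⧸ K2 n := QuotientGroup.mk' (K2 n) (aZ z)

lemma gq_gen : Subgroup.closure (Set.range (gq (n := n))) = ⊤ := by
  have h : Set.range (gq (n := n)) = QuotientGroup.mk' (K2 n) '' Set.range FreeGroup.of := by
    rw [← Set.range_comp]; rfl
  rw [h, ← MonoidHom.map_closure, FreeGroup.closure_range_of, ← MonoidHom.range_eq_map]
  exact MonoidHom.range_eq_top.2 (QuotientGroup.mk'_surjective _)

lemma gq_lcs : Subgroup.lowerCentralSeries (⊤ : Subgroup (F2 n ⧸ K2 n)) 3 = ⊥ := by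
  have h : (⊤ : Subgroup (F2 n ⧸ K2 n)) = Subgroup.map (QuotientGroup.mk' (K2 n)) ⊤ := by
    rw [← MonoidHom.range_eq_map]
    exact (MonoidHom.range_eq_top.2 (QuotientGroup.mk'_surjective _)).symm
  rw [h, ← Subgroup.map_lowerCentralSeries, Subgroup.map_eq_bot_iff, QuotientGroup.ker_mk']
  exact F4_le_K

lemma mk_eq_one {x : F2 n} : QuotientGroup.mk' (K2 n) x = 1 ↔ x ∈ K2 n :=
  QuotientGroup.eq_one_iff x

lemma gq_span : commutator (F2 n ⧸ K2 n) ≤ Subgroup.closure (Set.range (bas rk (gq (n := n)))) := by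
  refine derived_le_closure rk rk_inj gq gq_gen gq_lcs (fun z => ?_) (fun z z' => ?_)
  · simp only [gq]
    rw [← map_pow, mk_eq_one]; exact K_sq z
  · simp only [gq]
    rw [← map_gcomm, ← map_gcomm, mk_eq_one]; exact K_rep z z'

lemma H_to_comm {x : F2 n} (hx : x ∈ HH n) : QuotientGroup.mk' (K2 n) x ∈ commutator (F2 n ⧸ K2 n) := by
  have : HH n ≤ (commutator (F2 n ⧸ K2 n)).comap (QuotientGroup.mk' (K2 n)) := by
    refine sup_le ?_ ?_
    · rw [commutator_def, Subgroup.commutator_le]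
      intro x _ y _
      rw [Subgroup.mem_comap, map_commutatorElement, lie_eq_gcomm]
      exact gcomm_mem_commutator _ _
    · intro x hx
      rw [Subgroup.mem_comap, mk_eq_one.2 hx]
      exact one_mem _
  exact this hx

lemma bas_mem_H (t : TT (rk (n := n))) : bas rk (aZ (n := n)) t ∈ HH n := by
  refine (le_sup_left : commutator (F2 n) ≤ HH n) ?_
  rcases t with t | t <;> exact gcomm_mem_commutator _ _

lemma H_span : HH n ≤ Subgroup.closure (Set.range (bas rk (aZ (n := n)))) ⊔ K2 n := by
  intro x hx
  have h := gq_span (H_to_comm hx)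
  have hr : Set.range (bas rk (gq (n := n))) =
      QuotientGroup.mk' (K2 n) '' Set.range (bas rk (aZ (n := n))) := by
    rw [← Set.range_comp]
    congr 1
    funext t
    exact (map_bas (QuotientGroup.mk' (K2 n)) rk aZ t).symm
  rw [hr, ← MonoidHom.map_closure] at h
  obtain ⟨y, hy, hxy⟩ := h
  have h1 : y⁻¹ * x ∈ K2 n := by
    rw [← mk_eq_one, map_mul, map_inv, hxy]; simp
  have h2 : x = y * (y⁻¹ * x) := by group
  rw [h2]
  exact Subgroup.mul_mem_sup hy h1

lemma H_comm : ∀ g ∈ HH n, ∀ h ∈ HH n, gcomm g h ∈ K2 n := by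
  intro g hg h hh
  rw [← mk_eq_one, map_gcomm]
  have := derived_comm gq_lcs (H_to_comm hg) (H_to_comm hh)
  simp only [gcomm]
  rw [mul_assoc, this]
  group

lemma H_sq : ∀ h ∈ HH n, h * h ∈ K2 n := by
  intro h hh
  rw [← mk_eq_one, map_mul]
  have h1 := gq_span (H_to_comm hh)
  have key : ∀ x ∈ Subgroup.closure (Set.range (bas rk (gq (n := n)))),
      x ∈ commutator (F2 n ⧸ K2 n) ∧ x * x = 1 := by
    intro x hx
    induction hx using Subgroup.closure_induction with
    | one => exact ⟨one_mem _, by simp⟩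
    | mem x hx =>
      obtain ⟨t | t, rfl⟩ := hx
      · refine ⟨gcomm_mem_commutator _ _, ?_⟩
        simp only [bas, gq]
        rw [← map_gcomm, ← pow_two, ← map_pow, mk_eq_one]
        exact K_csq _ _
      · refine ⟨gcomm_mem_commutator _ _, ?_⟩
        simp only [bas, gq]
        rw [← map_gcomm, ← map_gcomm, ← pow_two, ← map_pow, mk_eq_one]
        exact K_tsq _ _ _
    | mul x y _ _ hx hy =>
      refine ⟨mul_mem hx.1 hy.1, ?_⟩
      have := derived_comm gq_lcs hx.1 hy.1
      calc x * y * (x * y) = x * (y * x) * y := by group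
        _ = x * (x * y) * y := by rw [this]
        _ = (x * x) * (y * y) := by group
        _ = 1 := by rw [hx.2, hy.2, one_mul]
    | inv x _ hx =>
      refine ⟨inv_mem hx.1, ?_⟩
      rw [← mul_inv_rev, hx.2, inv_one]
  exact (key _ h1).2

lemma sq_mem_H (h : F2 n) : h * h ∈ HH n := by
  induction h using FreeGroup.induction_on with
  | C1 => simp
  | of z =>
    have := K_le_H (K_sq z)
    rwa [pow_two] at this
  | inv_of z h =>
    rw [← mul_inv_rev]; exact inv_mem h
  | mul x y hx hy =>
    have : x * y * (x * y) = x * x * gcomm x y⁻¹ * (y * y) := by simp only [gcomm]; group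
    rw [this]
    exact mul_mem (mul_mem hx ((le_sup_left : commutator (F2 n) ≤ HH n)
      (gcomm_mem_commutator _ _))) hy

lemma K_le_I : K2 n ≤ I2 n := fun _ hx => Subgroup.subset_closure (Or.inl hx)

lemma I_AA (i j) : gcomm (aA i) (aA j) ∈ I2 n :=
  Subgroup.subset_closure (Or.inr (Or.inl (Or.inl (Or.inl (Or.inl ⟨i, j, rfl⟩)))))
lemma I_BB (i j) : gcomm (aB i) (aB j) ∈ I2 n :=
  Subgroup.subset_closure (Or.inr (Or.inl (Or.inl (Or.inl (Or.inr ⟨i, j, rfl⟩)))))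
lemma I_AAZ (i j z) : gcomm (gcomm (aA i) (aA j)) (aZ z) ∈ I2 n :=
  Subgroup.subset_closure (Or.inr (Or.inl (Or.inl (Or.inr ⟨i, j, z, rfl⟩))))
lemma I_BBZ (i j z) : gcomm (gcomm (aB i) (aB j)) (aZ z) ∈ I2 n :=
  Subgroup.subset_closure (Or.inr (Or.inl (Or.inr ⟨i, j, z, rfl⟩)))
lemma I_BAB (i j k) : gcomm (gcomm (aB i) (aA k)) (aB j) ∈ I2 n :=
  Subgroup.subset_closure (Or.inr (Or.inr ⟨i, j, k, rfl⟩))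

lemma I_ABB (i j k) : gcomm (gcomm (aA k) (aB i)) (aB j) ∈ I2 n := by
  have h : gcomm (gcomm (aA k) (aB i)) (aB j) * gcomm (gcomm (aB i) (aA k)) (aB j) ∈ K2 n := by
    rw [← mk_eq_one]
    simp only [map_mul, map_gcomm]
    rw [gcomm_swap (QuotientGroup.mk' (K2 n) (aB i)), gcomm_inv_left gq_lcs]
    group
  have h2 := mul_mem (K_le_I h) (inv_mem (I_BAB i j k))
  rwa [mul_inv_cancel_right] at h2

lemma I_le_H : I2 n ≤ HH n := by
  rw [I2, Subgroup.closure_le]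
  rintro x (hx | ((((⟨i, j, rfl⟩ | ⟨i, j, rfl⟩) | ⟨i, j, z, rfl⟩) | ⟨i, j, z, rfl⟩) |
    ⟨i, j, k, rfl⟩))
  · exact K_le_H hx
  all_goals exact (le_sup_left : commutator (F2 n) ≤ HH n) (gcomm_mem_commutator _ _)

lemma H_eq : commutator (F2 n) ⊔ I2 n = HH n :=
  le_antisymm (sup_le le_sup_left I_le_H) (sup_le le_sup_left (K_le_I.trans le_sup_right))

/-- Kronecker delta. -/
def dl (x z : Fin n ⊕ Fin n) : ZMod 2 := if z = x then 1 else 0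

/-- The coordinate functions dual to the basic commutators. -/
def cf : TT (rk (n := n)) → F2 n → ZMod 2
  | .inl p => fun g => (rho (dl p.1.1) (dl p.1.2) 0 g).d
  | .inr p => fun g => (rho (dl p.1.1) (dl p.1.2.1) (dl p.1.2.2) g).f

lemma dl_mul {x y : Fin n ⊕ Fin n} (h : x ≠ y) (z) : dl x z * dl y z = 0 := by
  unfold dl
  split_ifs with h1 h2
  · exact absurd (h1.symm.trans h2) h
  all_goals simp

lemma H_to_L1 (p q r : Fin n ⊕ Fin n → ZMod 2) (hpq : ∀ z, p z * q z = 0)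
    (hqr : ∀ z, q z * r z = 0) : HH n ≤ U4.L1.comap (rho p q r) := by
  refine sup_le ?_ ?_
  · rw [commutator_def, Subgroup.commutator_le]
    intro x _ y _
    rw [Subgroup.mem_comap, map_commutatorElement, lie_eq_gcomm]
    exact U4.gcomm_mem_L1 _ _
  · intro x hx
    have : rho p q r x = 1 := K_le_ker p q r hpq hqr hx
    rw [Subgroup.mem_comap, this]
    exact one_mem _

lemma cf_add (t : TT (rk (n := n))) : ∀ g ∈ HH n, ∀ h ∈ HH n, cf t (g * h) = cf t g + cf t h := by
  intro g hg h hh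
  rcases t with ⟨⟨x, y⟩, h1⟩ | ⟨⟨x, y, z⟩, h1, h2, h3⟩
  · have hxy : x ≠ y := by rintro rfl; exact lt_irrefl _ h1
    obtain ⟨k1, k2, k3⟩ := H_to_L1 (dl x) (dl y) 0 (dl_mul hxy) (by simp) hg
    simp only [cf, map_mul, U4.mul_d, k1]; ring
  · have hxy : x ≠ y := by rintro rfl; exact lt_irrefl _ h1
    obtain ⟨k1, k2, k3⟩ := H_to_L1 (dl x) (dl y) (dl z) (dl_mul hxy) (dl_mul h3) hg
    obtain ⟨l1, l2, l3⟩ := H_to_L1 (dl x) (dl y) (dl z) (dl_mul hxy) (dl_mul h3) hh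
    simp only [cf, map_mul, U4.mul_f, k1, l3]; ring

lemma cf_K (t : TT (rk (n := n))) : ∀ g ∈ K2 n, cf t g = 0 := by
  intro g hg
  rcases t with ⟨⟨x, y⟩, h1⟩ | ⟨⟨x, y, z⟩, h1, h2, h3⟩
  · have hxy : x ≠ y := by rintro rfl; exact lt_irrefl _ h1
    have : rho (dl x) (dl y) 0 g = 1 := K_le_ker _ _ _ (dl_mul hxy) (by simp) hg
    simp only [cf, this, U4.one_d]
  · have hxy : x ≠ y := by rintro rfl; exact lt_irrefl _ h1
    have : rho (dl x) (dl y) (dl z) g = 1 := K_le_ker _ _ _ (dl_mul hxy) (dl_mul h3) hg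
    simp only [cf, this, U4.one_f]

lemma cf_bas (s t : TT (rk (n := n))) : cf s (bas rk aZ t) = if s = t then 1 else 0 := by
  rcases s with ⟨⟨x, y⟩, h1⟩ | ⟨⟨x, y, z⟩, h1, h2, h3⟩ <;>
  rcases t with ⟨⟨u, v⟩, k1⟩ | ⟨⟨u, v, w⟩, k1, k2, k3⟩
  · simp only [cf, bas, map_gcomm]
    rw [U4.gcomm_d, rho_aZ, rho_aZ]
    simp only [Sum.inl.injEq, Subtype.mk.injEq, Prod.mk.injEq]
    simp only [dl] at *
    by_cases hx : u = x
    · subst hx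
      have hv : v ≠ u := by rintro rfl; exact lt_irrefl _ k1
      simp [hv, eq_comm]
    · by_cases hy : u = y ∧ v = x
      · obtain ⟨rfl, rfl⟩ := hy
        exact absurd h1 (not_lt.2 k1.le)
      · have hx' : ¬ x = u := fun h => hx h.symm
        simp only [hx, hx', if_false, false_and, zero_mul, zero_sub, neg_eq_zero]
        split_ifs <;> simp_all
  · simp only [cf, bas, map_gcomm]
    rw [U4.gcomm_d, U4.gcomm_a, U4.gcomm_b]
    simp
  · simp only [cf, bas, map_gcomm]
    have hxy : x ≠ y := by rintro rfl; exact lt_irrefl _ h1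
    have hxz : x ≠ z := by rintro rfl; exact lt_irrefl _ h2
    have cases4 : ∀ u, rho (dl x) (dl y) (dl z) (aZ u) = ⟨1, 0, 0, 0, 0, 0⟩ ∨
        rho (dl x) (dl y) (dl z) (aZ u) = ⟨0, 1, 0, 0, 0, 0⟩ ∨
        rho (dl x) (dl y) (dl z) (aZ u) = ⟨0, 0, 1, 0, 0, 0⟩ ∨
        rho (dl x) (dl y) (dl z) (aZ u) = ⟨0, 0, 0, 0, 0, 0⟩ := by
      intro u
      rw [rho_aZ]
      simp only [dl]
      by_cases e1 : u = x
      · subst e1; simp [hxy, hxz]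
      by_cases e2 : u = y
      · subst e2; simp [hxy.symm, h3]
      by_cases e3 : u = z
      · subst e3; simp [hxz.symm, Ne.symm h3]
      simp [e1, e2, e3]
    rw [if_neg (by simp)]
    rcases cases4 u with e | e | e | e <;> rcases cases4 v with e' | e' | e' | e' <;>
      rw [e, e'] <;> rfl
  · simp only [cf, bas, map_gcomm]
    rw [U4.gcomm_f _ _ (U4.gcomm_a _ _) (U4.gcomm_b _ _) (U4.gcomm_c _ _), U4.gcomm_d,
        U4.gcomm_e, rho_aZ, rho_aZ, rho_aZ]
    simp only [Sum.inr.injEq, Subtype.mk.injEq, Prod.mk.injEq]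
    simp only [dl] at *
    by_cases hx : u = x
    · subst hx
      have hv : v ≠ u := by rintro rfl; exact lt_irrefl _ k1
      have hw : w ≠ u := by rintro rfl; exact lt_irrefl _ k2
      simp only [hv, hw, if_true, if_false, one_mul, mul_zero, zero_mul, sub_zero, true_and]
      by_cases hvy : v = y <;> by_cases hwz : w = z <;> simp [hvy, hwz, eq_comm] <;> simp_all [eq_comm]
    · have hx' : ¬ x = u := fun h => hx h.symm
      have e1 : ¬ (u = y ∧ v = x) := by
        rintro ⟨rfl, rfl⟩; exact absurd h1 (not_lt.2 k1.le)
      have e2 : ¬ (w = x ∧ u = y) := by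
        rintro ⟨rfl, rfl⟩; exact absurd h1 (not_lt.2 k2.le)
      have e3 : ¬ (w = x ∧ u = z) := by
        rintro ⟨rfl, rfl⟩; exact absurd h2 (not_lt.2 k2.le)
      simp only [hx, hx', if_false, false_and, zero_mul, zero_sub]
      split_ifs <;> simp_all

/-- Index type of the basic commutators surviving in `F/I`. -/
abbrev QQ (n : ℕ) := (Fin n × Fin n) ⊕ ({p : Fin n × Fin n // p.1 < p.2} × Fin n)

/-- Inclusion of `QQ` in the index set of all basic commutators. -/
def qq : QQ n → TT (rk (n := n))
  | .inl p => .inl ⟨(.inl p.1, .inr p.2), by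
      have := p.1.2
      simp only [rk_inl, rk_inr]; omega⟩
  | .inr p => .inr ⟨(.inl p.1.1.1, .inr p.2, .inl p.1.1.2), by
      have := p.1.1.1.2
      have h := p.1.2
      simp only [rk_inl, rk_inr]
      exact ⟨by omega, h, by simp⟩⟩

lemma qq_inj : Function.Injective (qq (n := n)) := by
  rintro (⟨i, j⟩ | ⟨⟨⟨i, j⟩, h⟩, k⟩) (⟨i', j'⟩ | ⟨⟨⟨i', j'⟩, h'⟩, k'⟩) e <;>
    simp [qq] at e ⊢ <;> tauto

lemma cf_I (t : QQ n) : ∀ g ∈ I2 n, cf (qq t) g = 0 := by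
  intro g hg
  rcases t with ⟨i, j⟩ | ⟨⟨⟨i, j⟩, h⟩, k⟩
  · have : rho (dl (.inl i)) (dl (.inr j)) 0 g = 1 :=
      I_le_ker _ _ _ (by simp [dl]) (by simp [dl]) (by simp) hg
    simp only [cf, qq, this, U4.one_d]
  · have : rho (dl (.inl i)) (dl (.inr k)) (dl (.inl j)) g = 1 :=
      I_le_ker _ _ _ (by simp [dl]) (by simp [dl]) (by simp [dl]) hg
    simp only [cf, qq, this, U4.one_f]

lemma H_span_I : HH n ≤ Subgroup.closure (Set.range (fun t => bas rk (aZ (n := n)) (qq t))) ⊔ I2 n := by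
  refine H_span.trans (sup_le ((Subgroup.closure_le _).2 ?_) (K_le_I.trans le_sup_right))
  have hI : ∀ x ∈ I2 n, x ∈ Subgroup.closure (Set.range (fun t => bas rk (aZ (n := n)) (qq t))) ⊔ I2 n :=
    fun x hx => (le_sup_right : I2 n ≤ _) hx
  have hq : ∀ t, bas rk (aZ (n := n)) (qq t) ∈
      Subgroup.closure (Set.range (fun t => bas rk (aZ (n := n)) (qq t))) ⊔ I2 n :=
    fun t => (le_sup_left : Subgroup.closure _ ≤ _) (Subgroup.subset_closure ⟨t, rfl⟩)
  rintro _ ⟨⟨⟨u | u, v | v⟩, h1⟩ | ⟨⟨u | u, v | v, w | w⟩, h1, h2, h3⟩, rfl⟩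
  · exact hI _ (I_AA _ _)
  · exact hq (.inl (u, v))
  · exfalso; have := v.2; simp only [rk_inl, rk_inr] at h1; omega
  · exact hI _ (I_BB _ _)
  · exact hI _ (I_AAZ _ _ _)
  · exact hI _ (I_AAZ _ _ _)
  · refine hq (.inr (⟨(u, w), ?_⟩, v))
    simpa only [rk_inl, Fin.val_fin_lt] using h2
  · exact hI _ (I_ABB _ _ _)
  · exfalso; have := v.2; simp only [rk_inl, rk_inr] at h1; omega
  · exfalso; have := v.2; simp only [rk_inl, rk_inr] at h1; omega
  · exact hI _ (I_BBZ _ _ _)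
  · exact hI _ (I_BBZ _ _ _)

lemma relIndex_K_H : (K2 n).relIndex (HH n) = 2 ^ Fintype.card (TT (rk (n := n))) :=
  relIndex_of_dual H_sq H_comm (bas rk aZ) bas_mem_H H_span K_le_H cf cf_add cf_K cf_bas

lemma relIndex_I_H : (I2 n).relIndex (HH n) = 2 ^ Fintype.card (QQ n) :=
  relIndex_of_dual (fun h hh => K_le_I (H_sq h hh)) (fun g hg h hh => K_le_I (H_comm g hg h hh))
    (fun t => bas rk aZ (qq t)) (fun t => bas_mem_H _) H_span_I I_le_H (fun t => cf (qq t))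
    (fun t => cf_add _) cf_I (fun s t => by rw [cf_bas]; simp only [qq_inj.eq_iff])

lemma index_H : (HH n).index = 2 ^ (2 * n) := by
  rw [← Subgroup.relIndex_top_right]
  have h := relIndex_of_dual (N := HH n) (H := ⊤) (fun h _ => sq_mem_H h)
    (fun g _ h _ => (le_sup_left : commutator (F2 n) ≤ HH n) (gcomm_mem_commutator _ _))
    (aZ (n := n)) (fun _ => Subgroup.mem_top _)
    (by
      have : Set.range (aZ (n := n)) = Set.range FreeGroup.of := rfl
      rw [this, FreeGroup.closure_range_of]; exact le_sup_left) le_top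
    (fun z g => (rho (dl z) 0 0 g).a)
    (fun t g _ h _ => by rw [map_mul, U4.mul_a])
    (fun t g hg => (H_to_L1 (dl t) 0 0 (by simp) (by simp) hg).1)
    (fun s t => by rw [rho_aZ]; simp only [dl, eq_comm])
  rw [h]
  simp [two_mul]

end final

/-- `I/K` is elementary abelian of order `2^{(13n³−15n²+2n)/6}`, `F'I/I` is elementary
abelian of order `2^{(n³+n²)/2}`, and `F/I` is nilpotent of class exactly `3` and order
`2^{(n³+n²+4n)/2}`.  This is expressed quotient-freely: relative indices give the orders,
squares/commutators landing in the subgroup give elementary abelianness, and `F/I` has class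
exactly `3` iff `F_4 ≤ I` but `F_3 ≰ I`. -/
theorem statement11 (n : ℕ) (hn : 2 ≤ n) :
    ((K2 n).relIndex (I2 n) = 2 ^ ((13 * n ^ 3 - 15 * n ^ 2 + 2 * n) / 6) ∧
      (∀ g ∈ I2 n, g * g ∈ K2 n) ∧
      (∀ g ∈ I2 n, ∀ h ∈ I2 n, gcomm g h ∈ K2 n)) ∧
    ((I2 n).relIndex (commutator (F2 n) ⊔ I2 n) = 2 ^ ((n ^ 3 + n ^ 2) / 2) ∧
      (∀ g ∈ commutator (F2 n) ⊔ I2 n, g * g ∈ I2 n) ∧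
      (∀ g ∈ commutator (F2 n) ⊔ I2 n, ∀ h ∈ commutator (F2 n) ⊔ I2 n,
        gcomm g h ∈ I2 n)) ∧
    Subgroup.lowerCentralSeries (⊤ : Subgroup (F2 n)) 3 ≤ I2 n ∧
    ¬ Subgroup.lowerCentralSeries (⊤ : Subgroup (F2 n)) 2 ≤ I2 n ∧
    (I2 n).index = 2 ^ ((n ^ 3 + n ^ 2 + 4 * n) / 2) := by
  have hKI : (K2 n).relIndex (I2 n) * (I2 n).relIndex (HH n) = (K2 n).relIndex (HH n) :=
    Subgroup.relIndex_mul_relIndex _ _ _ K_le_I I_le_H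
  have hIH : (I2 n).relIndex (HH n) * (HH n).index = (I2 n).index :=
    Subgroup.relIndex_mul_index I_le_H
  have t2 := card_pairs (n + n)
  have t3 := card_triples (n + n)
  have q2 := card_pairs n
  have hT : Fintype.card (TT (rk (n := n))) =
      Fintype.card {p : Fin (n + n) × Fin (n + n) // p.1 < p.2} +
      Fintype.card {p : Fin (n + n) × Fin (n + n) × Fin (n + n) //
        p.1 < p.2.1 ∧ p.1 < p.2.2 ∧ p.2.1 ≠ p.2.2} := by
    rw [Fintype.card_sum, card_T2, card_T3]
  have hQ : Fintype.card (QQ n) = n ^ 2 +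
      Fintype.card {p : Fin n × Fin n // p.1 < p.2} * n := by
    rw [Fintype.card_sum, Fintype.card_prod, Fintype.card_prod, Fintype.card_fin, pow_two]
  generalize Fintype.card {p : Fin (n + n) × Fin (n + n) // p.1 < p.2} = T2 at t2 hT
  generalize Fintype.card {p : Fin (n + n) × Fin (n + n) × Fin (n + n) //
        p.1 < p.2.1 ∧ p.1 < p.2.2 ∧ p.2.1 ≠ p.2.2} = T3 at t3 hT
  generalize Fintype.card {p : Fin n × Fin n // p.1 < p.2} = c at q2 hQ
  have a1 : 2 * T2 + 2 * n = 4 * n ^ 2 := by linarith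
  have a2 : 3 * T3 + 12 * n ^ 2 = 8 * n ^ 3 + 4 * n := by linarith
  have a3 : 2 * (c * n) + n ^ 2 = n ^ 3 := by
    have : n * (c * 2 + n) = n * (n * n) := by rw [q2]
    linarith
  have a4 : 15 * n ^ 2 ≤ 13 * n ^ 3 := by
    have : n ^ 2 * 2 ≤ n ^ 2 * n := Nat.mul_le_mul_left _ hn
    have : n ^ 2 * n = n ^ 3 := by ring
    omega
  have e1 : Fintype.card (TT (rk (n := n))) =
      (13 * n ^ 3 - 15 * n ^ 2 + 2 * n) / 6 + Fintype.card (QQ n) := by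
    rw [hT, hQ]; omega
  have e2 : Fintype.card (QQ n) = (n ^ 3 + n ^ 2) / 2 := by rw [hQ]; omega
  have e3 : Fintype.card (QQ n) + 2 * n = (n ^ 3 + n ^ 2 + 4 * n) / 2 := by rw [hQ]; omega
  refine ⟨⟨?_, fun g hg => H_sq g (I_le_H hg), fun g hg h hh => H_comm g (I_le_H hg) h (I_le_H hh)⟩,
    ⟨?_, ?_, ?_⟩, F4_le_K.trans K_le_I, ?_, ?_⟩
  · rw [relIndex_K_H, relIndex_I_H, e1, pow_add] at hKI
    exact Nat.eq_of_mul_eq_mul_right (by positivity) hKI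
  · rw [H_eq, relIndex_I_H, e2]
  · rw [H_eq]; exact fun g hg => K_le_I (H_sq g hg)
  · rw [H_eq]; exact fun g hg h hh => K_le_I (H_comm g hg h hh)
  · intro hle
    let t : QQ n := .inr (⟨(⟨0, by omega⟩, ⟨1, by omega⟩), by simp [Fin.lt_def]⟩, ⟨0, by omega⟩)
    have h1 : bas rk (aZ (n := n)) (qq t) ∈ I2 n :=
      hle (gcomm_mem_lcs (gcomm_mem_lcs (k := 0) (Subgroup.mem_top _) _) _)
    have h2 := cf_I t _ h1
    rw [cf_bas, if_pos rfl] at h2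
    exact one_ne_zero h2
  · rw [← hIH, relIndex_I_H, index_H, ← pow_add, e3]
end

section
/- Let n ≥ 2 and let H(n) be the presented group defined above, with H(n)_3 the third term of its lower central series. Then the derived subgroup H(n)' is the internal direct product W × H(n)_3 and is elementary abelian of order 2^{n²(n+1)/2}, where: (a) W = ⟨[x_i,y_j] : 1 ≤ i,j ≤ n⟩ is elementary abelian of order 2^{n²}; and (b) H(n)_3 = ⟨[[x_i,y_j],x_k] : 1 ≤ i,j ≤ n, i < k ≤ n⟩ is elementary abelian of order 2^{n²(n−1)/2} and is contained in the centre of H(n). -/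
/-- The generator index set for `H(n)`: `Sum.inl i` is `x_i`, `Sum.inr j` is `y_j`. -/
abbrev HGen (n : ℕ) := Fin n ⊕ Fin n

/-- The word `x_i` in the free group. -/
def xw {n : ℕ} (i : Fin n) : FreeGroup (HGen n) := FreeGroup.of (Sum.inl i)

/-- The word `y_j` in the free group. -/
def yw {n : ℕ} (j : Fin n) : FreeGroup (HGen n) := FreeGroup.of (Sum.inr j)

/-- The word `z` in the free group, for a generator `z`. -/
def zw {n : ℕ} (z : HGen n) : FreeGroup (HGen n) := FreeGroup.of z

/-- The relators of the presentation of `H(n)`. -/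
def HRels (n : ℕ) : Set (FreeGroup (HGen n)) :=
  {w | ∃ z, w = zw z ^ 2} ∪
  {w | ∃ i j, w = gcomm (xw i) (xw j)} ∪
  {w | ∃ i j, w = gcomm (yw i) (yw j)} ∪
  {w | ∃ i j, w = gcomm (xw i) (yw j) ^ 2} ∪
  {w | ∃ i j k, w = gcomm (gcomm (yw j) (xw i)) (yw k)} ∪
  {w | ∃ i j z, w = gcomm (gcomm (xw i) (yw j)) (zw z) ^ 2} ∪
  {w | ∃ z₁ z₂ z₃ z₄, w = gcomm (gcomm (gcomm (zw z₁) (zw z₂)) (zw z₃)) (zw z₄)}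

/-- The group `H(n)` defined by the presentation. -/
abbrev Hn (n : ℕ) := PresentedGroup (HRels n)

/-- The image of the generator `x_i` in `H(n)`. -/
def xH {n : ℕ} (i : Fin n) : Hn n := PresentedGroup.of (Sum.inl i)

/-- The image of the generator `y_j` in `H(n)`. -/
def yH {n : ℕ} (j : Fin n) : Hn n := PresentedGroup.of (Sum.inr j)

/-- The subgroup `X = ⟨x_1, …, x_n⟩` of `H(n)`. -/
def XH (n : ℕ) : Subgroup (Hn n) := Subgroup.closure (Set.range (xH (n := n)))

/-- The subgroup `Y = ⟨y_1, …, y_n⟩` of `H(n)`. -/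
def YH (n : ℕ) : Subgroup (Hn n) := Subgroup.closure (Set.range (yH (n := n)))

/-- The subgroup `W = ⟨[x_i,y_j] : 1 ≤ i,j ≤ n⟩` of `H(n)`. -/
def Wsub (n : ℕ) : Subgroup (Hn n) :=
  Subgroup.closure {w | ∃ i j : Fin n, w = gcomm (xH i) (yH j)}


/-- Concrete model group. -/
@[ext] structure MG (n : ℕ) where
  v : Fin n → ZMod 2
  a : Fin n → ZMod 2
  b : Fin n → Fin n → ZMod 2
  c : Fin n → Fin n → Fin n → ZMod 2

namespace MG
variable {n : ℕ}

instance : Mul (MG n) := ⟨fun g h => ⟨fun i => g.v i + h.v i, fun j => g.a j + h.a j,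
  fun i j => g.b i j + g.a j * h.v i + h.b i j,
  fun i j k => g.c i j k + g.b i j * h.v k + g.b k j * h.v i + g.a j * h.v i * h.v k + h.c i j k⟩⟩

instance : One (MG n) := ⟨⟨fun _ => 0, fun _ => 0, fun _ _ => 0, fun _ _ _ => 0⟩⟩

instance : Inv (MG n) := ⟨fun g => ⟨fun i => - g.v i, fun j => - g.a j,
  fun i j => - g.b i j + g.a j * g.v i,
  fun i j k => - (g.c i j k + (- g.b i j + g.a j * g.v i) * g.v k +
    (- g.b k j + g.a j * g.v k) * g.v i - g.a j * g.v i * g.v k)⟩⟩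

@[simp] lemma mul_v (g h : MG n) (i) : (g * h).v i = g.v i + h.v i := rfl
@[simp] lemma mul_a (g h : MG n) (i) : (g * h).a i = g.a i + h.a i := rfl
@[simp] lemma mul_b (g h : MG n) (i j) :
    (g * h).b i j = g.b i j + g.a j * h.v i + h.b i j := rfl
@[simp] lemma mul_c (g h : MG n) (i j k) : (g * h).c i j k =
  g.c i j k + g.b i j * h.v k + g.b k j * h.v i + g.a j * h.v i * h.v k + h.c i j k := rfl
@[simp] lemma one_v (i) : (1 : MG n).v i = 0 := rfl
@[simp] lemma one_a (i) : (1 : MG n).a i = 0 := rfl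
@[simp] lemma one_b (i j) : (1 : MG n).b i j = 0 := rfl
@[simp] lemma one_c (i j k) : (1 : MG n).c i j k = 0 := rfl
@[simp] lemma inv_v (g : MG n) (i) : (g⁻¹).v i = - g.v i := rfl
@[simp] lemma inv_a (g : MG n) (i) : (g⁻¹).a i = - g.a i := rfl
@[simp] lemma inv_b (g : MG n) (i j) : (g⁻¹).b i j = - g.b i j + g.a j * g.v i := rfl
@[simp] lemma inv_c (g : MG n) (i j k) : (g⁻¹).c i j k =
  - (g.c i j k + (- g.b i j + g.a j * g.v i) * g.v k +
    (- g.b k j + g.a j * g.v k) * g.v i - g.a j * g.v i * g.v k) := rfl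

lemma ext' {g h : MG n} (h1 : ∀ i, g.v i = h.v i) (h2 : ∀ i, g.a i = h.a i)
    (h3 : ∀ i j, g.b i j = h.b i j) (h4 : ∀ i j k, g.c i j k = h.c i j k) : g = h :=
  MG.ext (funext h1) (funext h2) (funext fun i => funext (h3 i))
    (funext fun i => funext fun j => funext (h4 i j))

instance : Group (MG n) := Group.ofLeftAxioms
  (fun a b c => by apply ext' <;> intros <;> simp <;> ring)
  (fun a => by apply ext' <;> intros <;> simp)
  (fun a => by apply ext' <;> intros <;> simp only [mul_v, mul_a, mul_b, mul_c, inv_v, inv_a,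
    inv_b, inv_c, one_v, one_a, one_b, one_c] <;> ring)

/-- image of `x_i` -/
def X (i : Fin n) : MG n := ⟨Pi.single i 1, 0, 0, 0⟩
/-- image of `y_j` -/
def Y (i : Fin n) : MG n := ⟨0, Pi.single i 1, 0, 0⟩
/-- images of generators -/
def gen : HGen n → MG n := Sum.elim X Y

@[simp] lemma X_v (i : Fin n) (k) : (X i).v k = if k = i then 1 else 0 := by
  simp [X, Pi.single_apply]
@[simp] lemma X_a (i : Fin n) (k) : (X i).a k = 0 := rfl
@[simp] lemma X_b (i : Fin n) (k l) : (X i).b k l = 0 := rfl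
@[simp] lemma X_c (i : Fin n) (k l m) : (X i).c k l m = 0 := rfl
@[simp] lemma Y_a (i : Fin n) (k) : (Y i).a k = if k = i then 1 else 0 := by
  simp [Y, Pi.single_apply]
@[simp] lemma Y_v (i : Fin n) (k) : (Y i).v k = 0 := rfl
@[simp] lemma Y_b (i : Fin n) (k l) : (Y i).b k l = 0 := rfl
@[simp] lemma Y_c (i : Fin n) (k l m) : (Y i).c k l m = 0 := rfl

lemma gcomm_eq_one {G : Type*} [Group G] {g h : G} (e : g * h = h * g) : gcomm g h = 1 := by
  unfold gcomm
  rw [mul_assoc, e]; group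

/-- second layer -/
def P2 (g : MG n) : Prop := (∀ i, g.v i = 0) ∧ (∀ i, g.a i = 0)
/-- third layer -/
def P3 (g : MG n) : Prop := P2 g ∧ (∀ i j, g.b i j = 0)

lemma P2_gcomm (g h : MG n) : P2 (gcomm g h) := by
  constructor <;> intro i <;> simp only [gcomm, mul_v, mul_a, inv_v, inv_a] <;> ring
lemma P3_gcomm (g h : MG n) (hg : P2 g) : P3 (gcomm g h) :=
  ⟨P2_gcomm _ _, fun i j => by
    simp only [gcomm, mul_v, mul_a, mul_b, inv_v, inv_a, inv_b, hg.1, hg.2]; ring⟩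
lemma gcomm_P3 (g h : MG n) (hg : P3 g) : gcomm g h = 1 := by
  apply gcomm_eq_one
  apply ext' <;> intros <;> simp [hg.1.1, hg.1.2, hg.2] <;> ring
lemma gcomm_P2 (g h : MG n) (hg : P2 g) (hv : ∀ i, h.v i = 0) : gcomm g h = 1 := by
  apply gcomm_eq_one
  apply ext' <;> intros <;> simp [hg.1, hg.2, hv] <;> ring
lemma P2_sq (g : MG n) (hg : P2 g) : g ^ 2 = 1 := by
  rw [pow_two]
  apply ext' <;> intros <;> simp [hg.1, hg.2, CharTwo.add_self_eq_zero]

lemma rels : ∀ r ∈ HRels n, FreeGroup.lift gen r = 1 := by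
  have hx (i : Fin n) : FreeGroup.lift gen (xw i) = X i := by simp [xw, gen]
  have hy (i : Fin n) : FreeGroup.lift gen (yw i) = Y i := by simp [yw, gen]
  have hz (i : HGen n) : FreeGroup.lift gen (zw i) = gen i := by simp [zw]
  have hc (g h : FreeGroup (HGen n)) : FreeGroup.lift gen (gcomm g h) =
      gcomm (FreeGroup.lift gen g) (FreeGroup.lift gen h) := by simp [gcomm]
  intro r hr
  simp only [HRels, Set.mem_union, Set.mem_ofPred_eq] at hr
  rcases hr with (((((⟨z, rfl⟩ | ⟨i, j, rfl⟩) | ⟨i, j, rfl⟩) | ⟨i, j, rfl⟩) | ⟨i, j, k, rfl⟩) |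
    ⟨i, j, z, rfl⟩) | ⟨z₁, z₂, z₃, z₄, rfl⟩
  · rw [map_pow, hz, pow_two]
    rcases z with i | i <;> simp only [gen, Sum.elim_inl, Sum.elim_inr] <;>
    · apply ext' <;> intros <;> simp [CharTwo.add_self_eq_zero]
  · rw [hc, hx, hx]
    apply gcomm_eq_one
    apply ext' <;> intros <;> simp [add_comm]
  · rw [hc, hy, hy]
    apply gcomm_eq_one
    apply ext' <;> intros <;> simp [add_comm]
  · rw [map_pow, hc]; exact P2_sq _ (P2_gcomm _ _)
  · rw [hc, hc, hy k]; exact gcomm_P2 _ _ (P2_gcomm _ _) (by simp)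
  · rw [map_pow, hc]; exact P2_sq _ (P2_gcomm _ _)
  · rw [hc, hc, hc]; exact gcomm_P3 _ _ (P3_gcomm _ _ (P2_gcomm _ _))

/-- the homomorphism to the model -/
def φ : Hn n →* MG n := PresentedGroup.toGroup rels

lemma φ_x (i : Fin n) : φ (xH i) = X i := by simp [φ, xH, gen]
lemma φ_y (i : Fin n) : φ (yH i) = Y i := by simp [φ, yH, gen]
lemma φ_gcomm (g h : Hn n) : φ (gcomm g h) = gcomm (φ g) (φ h) := by simp [gcomm]

/-- second layer as a subgroup -/
def N2 (n : ℕ) : Subgroup (MG n) where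
  carrier := {g | P2 g}
  one_mem' := ⟨fun _ => rfl, fun _ => rfl⟩
  mul_mem' := fun ha hb => ⟨fun i => by simp [ha.1, hb.1], fun i => by simp [ha.2, hb.2]⟩
  inv_mem' := fun ha => ⟨fun i => by simp [ha.1], fun i => by simp [ha.2]⟩

/-- coordinates -/
def coordB (n : ℕ) : (N2 n).comap (φ (n := n)) →* Multiplicative (Fin n × Fin n → ZMod 2) where
  toFun g := Multiplicative.ofAdd fun p => (φ g.1).b p.1 p.2
  map_one' := by
    rw [← ofAdd_zero]; congr 1
  map_mul' g h := by
    rw [← ofAdd_add]; congr 1; funext p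
    have := g.2.2 p.2
    simp [this]

/-- index set for third layer -/
abbrev S (n : ℕ) := Fin n × {p : Fin n × Fin n // p.1 < p.2}

/-- coordinates -/
def coordC (n : ℕ) : (N2 n).comap (φ (n := n)) →* Multiplicative (S n → ZMod 2) where
  toFun g := Multiplicative.ofAdd fun p => (φ g.1).c p.2.1.1 p.1 p.2.1.2
  map_one' := by
    rw [← ofAdd_zero]; congr 1
  map_mul' g h := by
    rw [← ofAdd_add]; congr 1; funext p
    have h1 := g.2.2 
    have h2 := h.2.1
    simp [h1, h2]

/-- all coordinates -/
def coord (n : ℕ) : (N2 n).comap (φ (n := n)) →*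
    Multiplicative ((Fin n × Fin n) ⊕ S n → ZMod 2) where
  toFun g := Multiplicative.ofAdd
    (Sum.elim (Multiplicative.toAdd (coordB n g)) (Multiplicative.toAdd (coordC n g)))
  map_one' := by
    rw [← ofAdd_zero]; congr 1; funext p; rcases p with p | p <;> simp
  map_mul' g h := by
    rw [← ofAdd_add]; congr 1; funext p; rcases p with p | p <;> simp

/-- `w_{ij}` -/
def w (p : Fin n × Fin n) : Hn n := gcomm (xH p.1) (yH p.2)
/-- `t_{ijk}` -/
def t (p : S n) : Hn n := gcomm (gcomm (xH p.2.1.1) (yH p.1)) (xH p.2.1.2)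

lemma w_mem (p : Fin n × Fin n) : w p ∈ (N2 n).comap (φ (n := n)) := by
  rw [Subgroup.mem_comap, w, φ_gcomm]; exact P2_gcomm _ _
lemma t_mem (p : S n) : t p ∈ (N2 n).comap (φ (n := n)) := by
  rw [Subgroup.mem_comap, t, φ_gcomm]; exact P2_gcomm _ _

lemma two_cases : ∀ x : ZMod 2, -x = x := by decide

lemma coordB_w (p) : coordB n ⟨w p, w_mem p⟩ = Multiplicative.ofAdd (Pi.single p 1) := by
  simp only [coordB, MonoidHom.coe_mk, OneHom.coe_mk]
  congr 1; funext ⟨i, j⟩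
  obtain ⟨k, l⟩ := p
  simp only [w, φ_gcomm, φ_x, φ_y, Pi.single_apply, Prod.mk.injEq]
  by_cases h1 : i = k <;> by_cases h2 : j = l <;> simp [gcomm, h1, h2]

lemma coordC_w (p) : coordC n ⟨w p, w_mem p⟩ = 1 := by
  simp only [coordC, MonoidHom.coe_mk, OneHom.coe_mk]
  rw [← ofAdd_zero]
  congr 1; funext ⟨i, ⟨⟨j, m⟩, hlt⟩⟩
  obtain ⟨k, l⟩ := p
  simp only [w, φ_gcomm, φ_x, φ_y]
  by_cases h1 : j = k <;> by_cases h2 : i = l <;> by_cases h3 : m = k <;> 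
    simp [gcomm, h1, h2, h3]
  subst h1 h3; simp at hlt

lemma coordB_t (p) : coordB n ⟨t p, t_mem p⟩ = 1 := by
  simp only [coordB, MonoidHom.coe_mk, OneHom.coe_mk]
  rw [← ofAdd_zero]
  congr 1; funext ⟨i, j⟩
  simp only [t, φ_gcomm, φ_x, φ_y]
  exact (P3_gcomm _ _ (P2_gcomm _ _)).2 i j

lemma gcomm_c (g h : MG n) (hg : P2 g) (i j k) :
    (gcomm g h).c i j k = g.b i j * h.v k + g.b k j * h.v i := by
  have e : gcomm g h = gcomm g h := rfl
  have hw := P3_gcomm g h hg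
  have : h * g * gcomm g h = g * h := by unfold gcomm; group
  have h2 := congrArg (fun g => g.c i j k) this
  simp only [mul_c, hw.1.1, hw.1.2, hw.2, hg.1, hg.2] at h2
  simp at h2
  linear_combination h2

lemma coordC_t (p) : coordC n ⟨t p, t_mem p⟩ = Multiplicative.ofAdd (Pi.single p 1) := by
  simp only [coordC, MonoidHom.coe_mk, OneHom.coe_mk]
  congr 1; funext ⟨i, ⟨⟨j, m⟩, hlt⟩⟩
  obtain ⟨k, ⟨⟨l, q⟩, hlt2⟩⟩ := p
  simp only [t, φ_gcomm, φ_x, φ_y]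
  rw [gcomm_c _ _ (P2_gcomm _ _)]
  have hb (i j : Fin n) : (gcomm (X l) (Y k)).b i j = if i = l ∧ j = k then 1 else 0 := by
    by_cases h1 : i = l <;> by_cases h2 : j = k <;> simp [gcomm, h1, h2]
  simp only [hb, Pi.single_apply, Prod.mk.injEq, Subtype.mk.injEq, X_v]
  by_cases h1 : j = l
  · subst h1
    have : m ≠ j := hlt.ne'
    by_cases h2 : i = k <;> by_cases h3 : m = q <;> simp [h2, h3, this]
    subst h3; simp [this]
  · have : ¬ (m = l ∧ j = q) := by
      rintro ⟨rfl, rfl⟩; exact absurd hlt (not_lt.2 hlt2.le)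
    simp [h1]; tauto

end MG

section generic
variable {H : Type*} [Group H] {ι : Type*} [Fintype ι] [DecidableEq ι]

lemma sect_aux {K : Type*} [CommGroup K] (f : ι → K) (hsq : ∀ i, f i * f i = 1)
    (hcl : Subgroup.closure (Set.range f) = ⊤) (L : K →* Multiplicative (ι → ZMod 2))
    (hL : ∀ i, L (f i) = Multiplicative.ofAdd (Pi.single i 1)) : Function.Bijective L := by
  have key : ∀ i (a b : ZMod 2), f i ^ (a + b).val = f i ^ a.val * f i ^ b.val := by
    intro i a b
    rw [← pow_add, ZMod.val_add]
    exact (pow_eq_pow_mod _ (by rw [pow_two]; exact hsq i)).symm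
  let s : Multiplicative (ι → ZMod 2) →* K :=
    { toFun := fun v => ∏ i, f i ^ (Multiplicative.toAdd v i).val
      map_one' := by simp
      map_mul' := fun a b => by
        rw [← Finset.prod_mul_distrib]
        exact Finset.prod_congr rfl fun i _ => key i _ _ }
  have hs : ∀ i, s (Multiplicative.ofAdd (Pi.single i 1)) = f i := by
    intro i
    simp only [s, MonoidHom.coe_mk, OneHom.coe_mk, toAdd_ofAdd]
    rw [Finset.prod_eq_single i]
    · simp [ZMod.val_one]
    · intro j _ hj; simp [hj]
    · simp
  constructor
  · have : s.comp L = MonoidHom.id K := by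
      apply MonoidHom.eq_of_eqOn_dense hcl
      rintro _ ⟨i, rfl⟩
      simp [hL, hs]
    exact Function.LeftInverse.injective (g := s) (fun k => DFunLike.congr_fun this k)
  · intro v
    refine ⟨s v, ?_⟩
    simp only [s, MonoidHom.coe_mk, OneHom.coe_mk, map_prod, map_pow, hL]
    rw [← ofAdd_toAdd v, ← Multiplicative.toAdd.injective.eq_iff]
    simp only [toAdd_prod, toAdd_pow, toAdd_ofAdd]
    funext k
    rw [Finset.sum_apply, Finset.sum_eq_single k]
    · simp
    · intro j _ hj; simp [hj.symm]
    · simp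

lemma elem_ab (f : ι → H) (hcomm : ∀ i j, f i * f j = f j * f i) (hsq : ∀ i, f i * f i = 1)
    (M : Subgroup H) (hM : ∀ i, f i ∈ M) (L : M →* Multiplicative (ι → ZMod 2))
    (hL : ∀ i, L ⟨f i, hM i⟩ = Multiplicative.ofAdd (Pi.single i 1)) :
    Nat.card (Subgroup.closure (Set.range f)) = 2 ^ Fintype.card ι ∧
    (∀ g ∈ Subgroup.closure (Set.range f), ∀ h ∈ Subgroup.closure (Set.range f),
      g * h = h * g) ∧
    (∀ g ∈ Subgroup.closure (Set.range f), g * g = 1) ∧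
    (∀ g (hg : g ∈ M), g ∈ Subgroup.closure (Set.range f) → L ⟨g, hg⟩ = 1 → g = 1) := by
  let K := Subgroup.closure (Set.range f)
  letI : CommGroup K := Subgroup.closureCommGroupOfComm (by
    rintro _ ⟨i, rfl⟩ _ ⟨j, rfl⟩; exact hcomm i j)
  have hKM : K ≤ M := (Subgroup.closure_le _).2 (by rintro _ ⟨i, rfl⟩; exact hM i)
  let f' : ι → K := fun i => ⟨f i, Subgroup.subset_closure ⟨i, rfl⟩⟩
  have hf' : Subgroup.closure (Set.range f') = ⊤ := by
    rw [← Subgroup.closure_closure_coe_preimage (k := Set.range f)]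
    congr 1
    ext ⟨x, hx⟩
    simp [f', K]
  have hb := sect_aux f' (fun i => Subtype.ext (hsq i)) hf' (L.comp (Subgroup.inclusion hKM)) hL
  refine ⟨?_, ?_, ?_, ?_⟩
  · rw [Nat.card_congr (Equiv.ofBijective _ hb)]
    rw [Nat.card_congr Multiplicative.toAdd]
    simp
  · intro g hg h hh
    exact congrArg Subtype.val (mul_comm (⟨g, hg⟩ : K) ⟨h, hh⟩)
  · intro g hg
    have : (⟨g, hg⟩ : K) * ⟨g, hg⟩ = 1 := by
      apply hb.1
      rw [map_mul, map_one, ← Multiplicative.toAdd.injective.eq_iff]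
      funext i
      exact CharTwo.add_self_eq_zero _
    exact congrArg Subtype.val this
  · intro g hg hgK h1
    have : (⟨g, hgK⟩ : K) = 1 := hb.1 (by rw [map_one]; exact h1)
    exact congrArg Subtype.val this
end generic

namespace MG
variable {n : ℕ}
open scoped commutatorElement

lemma comm_of_gcomm {G : Type*} [Group G] {g h : G} (e : gcomm g h = 1) : g * h = h * g := by
  have : h * g * gcomm g h = g * h := by unfold gcomm; group
  rw [← this, e, mul_one]

/-- image of a generator -/
def zH (z : HGen n) : Hn n := PresentedGroup.of z

lemma map_gcomm' {G K : Type*} [Group G] [Group K] (f : G →* K) (g h : G) :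
    f (gcomm g h) = gcomm (f g) (f h) := by simp [gcomm]

lemma mk_x (i : Fin n) : PresentedGroup.mk (HRels n) (xw i) = xH i := rfl
lemma mk_y (i : Fin n) : PresentedGroup.mk (HRels n) (yw i) = yH i := rfl
lemma mk_z (i : HGen n) : PresentedGroup.mk (HRels n) (zw i) = zH i := rfl

lemma zz (z : HGen n) : zH z * zH z = 1 := by
  have : zw z ^ 2 ∈ HRels n := by
    simp only [HRels, Set.mem_union, Set.mem_ofPred_eq]
    exact Or.inl (Or.inl (Or.inl (Or.inl (Or.inl (Or.inl ⟨z, rfl⟩)))))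
  have := PresentedGroup.one_of_mem this
  rwa [map_pow, mk_z, pow_two] at this
lemma xx (i : Fin n) : xH i * xH i = 1 := zz (Sum.inl i)
lemma yy (i : Fin n) : yH i * yH i = 1 := zz (Sum.inr i)
lemma xc (i j : Fin n) : xH i * xH j = xH j * xH i := by
  have : gcomm (xw i) (xw j) ∈ HRels n := by
    simp only [HRels, Set.mem_union, Set.mem_ofPred_eq]
    exact Or.inl (Or.inl (Or.inl (Or.inl (Or.inl (Or.inr ⟨i, j, rfl⟩)))))
  have := PresentedGroup.one_of_mem this
  rw [map_gcomm', mk_x, mk_x] at this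
  exact comm_of_gcomm this
lemma yc (i j : Fin n) : yH i * yH j = yH j * yH i := by
  have : gcomm (yw i) (yw j) ∈ HRels n := by
    simp only [HRels, Set.mem_union, Set.mem_ofPred_eq]
    exact Or.inl (Or.inl (Or.inl (Or.inl (Or.inr ⟨i, j, rfl⟩))))
  have := PresentedGroup.one_of_mem this
  rw [map_gcomm', mk_y, mk_y] at this
  exact comm_of_gcomm this
lemma wsq (p : Fin n × Fin n) : w p * w p = 1 := by
  have : gcomm (xw p.1) (yw p.2) ^ 2 ∈ HRels n := by
    simp only [HRels, Set.mem_union, Set.mem_ofPred_eq]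
    exact Or.inl (Or.inl (Or.inl (Or.inr ⟨_, _, rfl⟩)))
  have := PresentedGroup.one_of_mem this
  rwa [map_pow, map_gcomm', mk_x, mk_y, pow_two] at this
lemma winv (p : Fin n × Fin n) : (w p)⁻¹ = w p := inv_eq_of_mul_eq_one_left (wsq p)
lemma wy (p : Fin n × Fin n) (k : Fin n) : w p * yH k = yH k * w p := by
  have : gcomm (gcomm (yw p.2) (xw p.1)) (yw k) ∈ HRels n := by
    simp only [HRels, Set.mem_union, Set.mem_ofPred_eq]
    exact Or.inl (Or.inl (Or.inr ⟨_, _, _, rfl⟩))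
  have := PresentedGroup.one_of_mem this
  rw [map_gcomm', map_gcomm', mk_x, mk_y, mk_y] at this
  have h := comm_of_gcomm this
  have e : gcomm (yH p.2) (xH p.1) = (w p)⁻¹ := by simp only [gcomm, w]; group
  rwa [e, winv] at h

/-- general third-layer element -/
def T (i j k : Fin n) : Hn n := gcomm (gcomm (xH i) (yH j)) (xH k)

lemma Tsq (i j k : Fin n) : T i j k * T i j k = 1 := by
  have : gcomm (gcomm (xw i) (yw j)) (zw (Sum.inl k)) ^ 2 ∈ HRels n := by
    simp only [HRels, Set.mem_union, Set.mem_ofPred_eq]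
    exact Or.inl (Or.inr ⟨_, _, _, rfl⟩)
  have := PresentedGroup.one_of_mem this
  rwa [map_pow, map_gcomm', map_gcomm', mk_x, mk_y, pow_two] at this

lemma mem_center_of {Q : Type*} [Group Q] (π : Hn n →* Q) (hπ : Function.Surjective π) (q : Q)
    (hx : ∀ i, q * π (xH i) = π (xH i) * q) (hy : ∀ i, q * π (yH i) = π (yH i) * q) :
    q ∈ Subgroup.center Q := by
  have : (⊤ : Subgroup (Hn n)) ≤ (Subgroup.centralizer {q}).comap π := by
    rw [← PresentedGroup.closure_range_of, Subgroup.closure_le]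
    rintro _ ⟨z, rfl⟩
    simp only [Subgroup.coe_comap, Set.mem_preimage, SetLike.mem_coe,
      Subgroup.mem_centralizer_singleton_iff]
    rcases z with i | i
    · exact (hx i).symm
    · exact (hy i).symm
  rw [Subgroup.mem_center_iff]
  intro g
  obtain ⟨g, rfl⟩ := hπ g
  have := this (Subgroup.mem_top g)
  simpa [Subgroup.mem_centralizer_singleton_iff] using this

lemma T_center (i j k : Fin n) : T i j k ∈ Subgroup.center (Hn n) := by
  have key : ∀ z, T i j k * zH z = zH z * T i j k := by
    intro z
    have : gcomm (gcomm (gcomm (zw (Sum.inl i)) (zw (Sum.inr j))) (zw (Sum.inl k))) (zw z)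
        ∈ HRels n := by
      simp only [HRels, Set.mem_union, Set.mem_ofPred_eq]
      exact Or.inr ⟨_, _, _, _, rfl⟩
    have := PresentedGroup.one_of_mem this
    rw [map_gcomm', map_gcomm', map_gcomm'] at this
    exact comm_of_gcomm this
  exact mem_center_of (MonoidHom.id _) Function.surjective_id _
    (fun i => key (Sum.inl i)) (fun i => key (Sum.inr i))

lemma T_comm (i j k : Fin n) (g : Hn n) : T i j k * g = g * T i j k :=
  ((Subgroup.mem_center_iff.1 (T_center i j k)) g).symm

lemma wx (i j k : Fin n) : w (i, j) * xH k = xH k * w (i, j) * T i j k := by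
  simp only [T, w, gcomm]; group

lemma wx' (i j k : Fin n) : xH k * w (i, j) = w (i, j) * xH k * T i j k := by
  rw [wx, mul_assoc _ (T i j k), Tsq, mul_one]

lemma ww (p q : Fin n × Fin n) : w p * w q = w q * w p := by
  obtain ⟨i, j⟩ := p
  obtain ⟨k, l⟩ := q
  have hx : (xH k)⁻¹ = xH k := inv_eq_of_mul_eq_one_left (xx k)
  have hy : (yH l)⁻¹ = yH l := inv_eq_of_mul_eq_one_left (yy l)
  have e : w (k, l) = xH k * yH l * (xH k * yH l) := by
    simp only [w, gcomm, hx, hy]; group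
  have h1 : w (i, j) * (xH k * yH l) = (xH k * yH l) * w (i, j) * T i j k := by
    rw [← mul_assoc, wx, mul_assoc _ (T i j k), T_comm, mul_assoc (xH k), ← mul_assoc (w _),
      wy]
    simp only [mul_assoc]
  rw [e, ← mul_assoc, h1, mul_assoc _ (T i j k), T_comm, ← mul_assoc, mul_assoc _ (w _), h1]
  simp only [mul_assoc, Tsq, mul_one]

lemma T_diag (i j : Fin n) : T i j i = 1 := by
  have hx : (xH i)⁻¹ = xH i := inv_eq_of_mul_eq_one_left (xx i)
  have hy : (yH j)⁻¹ = yH j := inv_eq_of_mul_eq_one_left (yy j)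
  have hw : w (i, j) = xH i * yH j * xH i * yH j := by simp only [w, gcomm, hx, hy]
  have hw' : w (i, j) = yH j * xH i * yH j * xH i := by
    rw [← winv, w]; simp only [gcomm, hx, hy, mul_inv_rev, mul_assoc]
  apply gcomm_eq_one
  change w (i, j) * xH i = xH i * w (i, j)
  rw [hw]
  conv_rhs => rw [← hw, hw']
  simp only [mul_assoc]

lemma T_symm (i j k : Fin n) : T i j k = T k j i := by
  have hx : (xH i)⁻¹ = xH i := inv_eq_of_mul_eq_one_left (xx i)
  have hy : (yH j)⁻¹ = yH j := inv_eq_of_mul_eq_one_left (yy j)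
  have main : ∀ i k : Fin n, xH i * xH k * yH j * (xH i * xH k) * yH j =
      w (i, j) * w (k, j) * T i j k := by
    intro i k
    have hx : ∀ k : Fin n, (xH k)⁻¹ = xH k := fun k => inv_eq_of_mul_eq_one_left (xx k)
    have hw : ∀ i, w (i, j) = xH i * yH j * xH i * yH j := fun i => by
      simp only [w, gcomm, hx, hy]
    calc xH i * xH k * yH j * (xH i * xH k) * yH j
        = xH k * w (i, j) * yH j * xH k * yH j := by
          rw [hw, xc i k]; simp only [mul_assoc]
          rw [← mul_assoc (yH j) (yH j), yy, one_mul, ← mul_assoc (xH k) (xH i) (yH j), xc k i]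
          simp only [mul_assoc]
      _ = w (i, j) * (xH k * yH j * xH k * yH j) * T i j k := by
          rw [wx']
          simp only [mul_assoc, T_comm]
      _ = _ := by rw [← hw]
  have h := main i k
  rw [xc i k, main k i, ww] at h
  exact (mul_left_cancel h).symm

lemma range_w : Set.range (w (n := n)) = {w | ∃ i j : Fin n, w = gcomm (xH i) (yH j)} := by
  ext g; constructor
  · rintro ⟨p, rfl⟩; exact ⟨_, _, rfl⟩
  · rintro ⟨i, j, rfl⟩; exact ⟨(i, j), rfl⟩

lemma range_t : Set.range (t (n := n)) =
    {w | ∃ i j k : Fin n, i < k ∧ w = gcomm (gcomm (xH i) (yH j)) (xH k)} := by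
  ext g; constructor
  · rintro ⟨p, rfl⟩; exact ⟨_, _, _, p.2.2, rfl⟩
  · rintro ⟨i, j, k, h, rfl⟩; exact ⟨(j, ⟨(i, k), h⟩), rfl⟩

lemma T_mem (i j k : Fin n) : T i j k ∈ Subgroup.closure (Set.range (t (n := n))) := by
  rcases lt_trichotomy i k with h | h | h
  · exact Subgroup.subset_closure ⟨(j, ⟨(i, k), h⟩), rfl⟩
  · subst h; rw [T_diag]; exact one_mem _
  · rw [T_symm]; exact Subgroup.subset_closure ⟨(j, ⟨(k, i), h⟩), rfl⟩

/-- third layer subgroup -/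
abbrev TT (n : ℕ) : Subgroup (Hn n) := Subgroup.closure (Set.range (t (n := n)))
/-- second layer subgroup -/
abbrev WW (n : ℕ) : Subgroup (Hn n) := Subgroup.closure (Set.range (w (n := n)))

lemma TT_center : TT n ≤ Subgroup.center (Hn n) := by
  rw [Subgroup.closure_le]
  rintro _ ⟨p, rfl⟩
  exact T_center _ _ _

instance TT_normal : (TT n).Normal := ⟨fun a ha g => by
  have := Subgroup.mem_center_iff.1 (TT_center ha) g
  rw [this]; simpa using ha⟩

/-- commuting modulo the third layer -/
lemma WT_mod : WW n ⊔ TT n ≤ (Subgroup.center (Hn n ⧸ TT n)).comap (QuotientGroup.mk' (TT n)) := by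
  refine sup_le ?_ ?_
  · rw [Subgroup.closure_le]
    rintro _ ⟨p, rfl⟩
    refine mem_center_of (QuotientGroup.mk' (TT n)) (QuotientGroup.mk'_surjective _) _ ?_ ?_
    · intro k
      rw [← map_mul, ← map_mul, wx p.1 p.2 k, map_mul _ _ (T _ _ _)]
      have : QuotientGroup.mk' (TT n) (T p.1 p.2 k) = 1 :=
        (QuotientGroup.eq_one_iff _).2 (T_mem _ _ _)
      rw [this, mul_one]
    · intro k
      rw [← map_mul, ← map_mul, wy]
  · intro g hg
    have : QuotientGroup.mk' (TT n) g = 1 := (QuotientGroup.eq_one_iff _).2 hg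
    rw [Subgroup.mem_comap, this]; exact one_mem _

lemma WT_comm : ⁅WW n ⊔ TT n, (⊤ : Subgroup (Hn n))⁆ ≤ TT n := by
  rw [Subgroup.commutator_le]
  intro g hg h _
  rw [← QuotientGroup.eq_one_iff]
  have := Subgroup.mem_center_iff.1 (WT_mod hg) (QuotientGroup.mk' (TT n) h)
  change QuotientGroup.mk' (TT n) ⁅g, h⁆ = 1
  rw [map_commutatorElement, commutatorElement_eq_one_iff_mul_comm]
  exact this.symm

instance WT_normal : (WW n ⊔ TT n).Normal := by
  refine ⟨fun a ha g => ?_⟩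
  have := WT_comm (Subgroup.commutator_mem_commutator ha (Subgroup.mem_top g))
  have h2 := (WW n ⊔ TT n).mul_mem ((WW n ⊔ TT n).inv_mem (le_sup_right (a := WW n) this)) ha
  have e : (⁅a, g⁆)⁻¹ * a = g * a * g⁻¹ := by rw [commutatorElement_def]; group
  rwa [e] at h2

lemma gcomm_mem {G : Type*} [Group G] (A B : Subgroup G) [B.Normal] [A.Normal] {g h : G}
    (hg : g ∈ A) (hh : h ∈ B) : gcomm g h ∈ ⁅A, B⁆ := by
  have := Subgroup.commutator_mem_commutator (A.inv_mem hg) (B.inv_mem hh)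
  rw [commutatorElement_def] at this
  simpa [gcomm] using this

lemma comm_eq : commutator (Hn n) = WW n ⊔ TT n := by
  apply le_antisymm
  · let π := QuotientGroup.mk' (WW n ⊔ TT n)
    have hπ : Function.Surjective π := QuotientGroup.mk'_surjective _
    have hxy : ∀ i j : Fin n, π (xH i) * π (yH j) = π (yH j) * π (xH i) := by
      intro i j
      apply comm_of_gcomm
      rw [← map_gcomm']
      exact (QuotientGroup.eq_one_iff _).2
        (le_sup_left (b := TT n) (Subgroup.subset_closure ⟨(i, j), rfl⟩))
    have hgen : ∀ z, π (zH z) ∈ Subgroup.center (Hn n ⧸ (WW n ⊔ TT n)) := by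
      rintro (i | i)
      · exact mem_center_of π hπ _
          (fun k => by rw [← map_mul, ← map_mul]; exact congrArg π (xc i k)) (fun k => hxy i k)
      · exact mem_center_of π hπ _ (fun k => (hxy k i).symm)
          (fun k => by rw [← map_mul, ← map_mul]; exact congrArg π (yc i k))
    have htop : ∀ g, π g ∈ Subgroup.center (Hn n ⧸ (WW n ⊔ TT n)) := by
      intro g
      have : (⊤ : Subgroup (Hn n)) ≤
          (Subgroup.center (Hn n ⧸ (WW n ⊔ TT n))).comap π := by
        rw [← PresentedGroup.closure_range_of, Subgroup.closure_le]
        rintro _ ⟨z, rfl⟩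
        exact hgen z
      exact this (Subgroup.mem_top g)
    rw [commutator_def, Subgroup.commutator_le]
    intro g _ h _
    rw [← QuotientGroup.eq_one_iff]
    change π ⁅g, h⁆ = 1
    rw [map_commutatorElement, commutatorElement_eq_one_iff_mul_comm]
    exact Subgroup.mem_center_iff.1 (htop h) _
  · have hw : ∀ p, w p ∈ commutator (Hn n) := fun p =>
      gcomm_mem ⊤ ⊤ (Subgroup.mem_top _) (Subgroup.mem_top _)
    refine sup_le ?_ ?_ <;> rw [Subgroup.closure_le] <;> rintro _ ⟨p, rfl⟩
    · exact hw p
    · exact gcomm_mem ⊤ ⊤ (Subgroup.mem_top _) (Subgroup.mem_top _)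

lemma lcs_eq : Subgroup.lowerCentralSeries (⊤ : Subgroup (Hn n)) 2 = TT n := by
  have e : Subgroup.lowerCentralSeries (⊤ : Subgroup (Hn n)) 2 = ⁅commutator (Hn n), ⊤⁆ := rfl
  rw [e]
  apply le_antisymm
  · rw [comm_eq]; exact WT_comm
  · rw [Subgroup.closure_le]; rintro _ ⟨p, rfl⟩
    exact gcomm_mem _ ⊤ (gcomm_mem ⊤ ⊤ (Subgroup.mem_top _) (Subgroup.mem_top _))
      (Subgroup.mem_top _)

/-- the full family -/
def f : (Fin n × Fin n) ⊕ S n → Hn n := Sum.elim w t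

lemma closure_f : Subgroup.closure (Set.range (f (n := n))) = WW n ⊔ TT n := by
  rw [f, Set.Sum.elim_range, Subgroup.closure_union]

lemma t_comm (p : S n) (g : Hn n) : t p * g = g * t p := T_comm _ _ _ g
lemma t_sq (p : S n) : t p * t p = 1 := Tsq _ _ _

lemma f_mem (p) : f p ∈ (N2 n).comap (φ (n := n)) := by
  rcases p with p | p
  · exact w_mem p
  · exact t_mem p

lemma coord_f (p) : coord n ⟨f p, f_mem p⟩ = Multiplicative.ofAdd (Pi.single p 1) := by
  rcases p with p | p
  · have e1 := coordB_w p
    have e2 := coordC_w p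
    change Multiplicative.ofAdd (Sum.elim (Multiplicative.toAdd (coordB n ⟨w p, w_mem p⟩))
      (Multiplicative.toAdd (coordC n ⟨w p, w_mem p⟩))) = _
    rw [e1, e2]
    congr 1; funext q; rcases q with q | q <;> simp [Pi.single_apply]
  · have e1 := coordB_t p
    have e2 := coordC_t p
    change Multiplicative.ofAdd (Sum.elim (Multiplicative.toAdd (coordB n ⟨t p, t_mem p⟩))
      (Multiplicative.toAdd (coordC n ⟨t p, t_mem p⟩))) = _
    rw [e1, e2]
    congr 1; funext q; rcases q with q | q <;> simp [Pi.single_apply]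

lemma card_lt (n : ℕ) : Fintype.card {p : Fin n × Fin n // p.1 < p.2} * 2 + n = n ^ 2 := by
  classical
  have e : Fintype.card {p : Fin n × Fin n // p.1 < p.2} =
      Fintype.card {p : Fin n × Fin n // p.2 < p.1} :=
    Fintype.card_congr ((Equiv.prodComm _ _).subtypeEquiv (by simp))
  have e2 : Fintype.card {p : Fin n × Fin n // p.1 = p.2} = n := by
    rw [Fintype.card_congr (β := Fin n) ⟨fun p => p.1.1, fun i => ⟨(i, i), rfl⟩,
      fun ⟨⟨a, b⟩, h⟩ => by simpa using h, fun _ => rfl⟩]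
    simp
  have tot : Fintype.card (Fin n × Fin n) = n ^ 2 := by simp [pow_two]
  have h1 := Fintype.card_subtype_compl (fun p : Fin n × Fin n => p.1 < p.2)
  have h2 : Fintype.card {p : Fin n × Fin n // ¬ p.1 < p.2} =
      Fintype.card {p : Fin n × Fin n // p.2 < p.1} +
      Fintype.card {p : Fin n × Fin n // p.1 = p.2} := by
    rw [← Fintype.card_subtype_or_disjoint]
    · apply Fintype.card_congr
      apply Equiv.subtypeEquivRight
      intro p
      rw [not_lt, le_iff_lt_or_eq, eq_comm (a := p.2)]
    · rw [Pi.disjoint_iff]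
      intro p
      rw [Prop.disjoint_iff]
      exact fun h => h.1.ne h.2.symm
  have h3 := Fintype.card_subtype_le (fun p : Fin n × Fin n => p.1 < p.2)
  omega

lemma card_S (n : ℕ) : Fintype.card (S n) = n ^ 2 * (n - 1) / 2 := by
  have h := card_lt n
  rw [Fintype.card_prod, Fintype.card_fin]
  symm
  apply Nat.div_eq_of_eq_mul_left two_pos
  rcases n with _ | m
  · simp
  · have : Fintype.card {p : Fin (m + 1) × Fin (m + 1) // p.1 < p.2} * 2 = (m + 1) * m := by
      nlinarith
    rw [mul_assoc, this]; simp only [Nat.add_sub_cancel]; ring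

lemma card_all (n : ℕ) : Fintype.card ((Fin n × Fin n) ⊕ S n) = n ^ 2 * (n + 1) / 2 := by
  have h := card_lt n
  rw [Fintype.card_sum, Fintype.card_prod, Fintype.card_prod, Fintype.card_fin]
  symm
  apply Nat.div_eq_of_eq_mul_left two_pos
  nlinarith

lemma WT_inf : WW n ⊓ TT n = ⊥ := by
  have h0 : WW n ≤ (coordC n).ker.map (Subgroup.subtype _) := by
    rw [Subgroup.closure_le]
    rintro _ ⟨p, rfl⟩
    exact ⟨⟨w p, w_mem p⟩, coordC_w p, rfl⟩
  rw [eq_bot_iff]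
  rintro g ⟨hw, ht⟩
  obtain ⟨⟨g, hg⟩, h1, rfl⟩ := h0 hw
  exact (elem_ab t (fun p q => t_comm p _) t_sq _ t_mem (coordC n) coordC_t).2.2.2 g hg ht h1

lemma f_comm (p q : (Fin n × Fin n) ⊕ S n) : f p * f q = f q * f p := by
  rcases p with p | p <;> rcases q with q | q
  · exact ww p q
  · exact (t_comm q _).symm
  · exact t_comm p _
  · exact t_comm p _

lemma f_sq (p : (Fin n × Fin n) ⊕ S n) : f p * f p = 1 := by
  rcases p with p | p
  · exact wsq p
  · exact t_sq p

end MG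

/-- `H(n)' = W × H(n)_3` is elementary abelian of order `2^{n²(n+1)/2}`, where
(a) `W = ⟨[x_i,y_j]⟩` is elementary abelian of order `2^{n²}`, and
(b) `H(n)_3 = ⟨[[x_i,y_j],x_k] : i < k⟩` is elementary abelian of order `2^{n²(n-1)/2}`
and is central (Mathlib's `lowerCentralSeries (Hn n) 2` is `H(n)_3`). -/
theorem statement16 (n : ℕ) (hn : 2 ≤ n) :
    (Subgroup.lowerCentralSeries (⊤ : Subgroup (Hn n)) 2 =
      Subgroup.closure {w | ∃ i j k : Fin n, i < k ∧ w = gcomm (gcomm (xH i) (yH j)) (xH k)}) ∧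
    commutator (Hn n) = Wsub n ⊔ Subgroup.lowerCentralSeries (⊤ : Subgroup (Hn n)) 2 ∧
    Wsub n ⊓ Subgroup.lowerCentralSeries (⊤ : Subgroup (Hn n)) 2 = ⊥ ∧
    Nat.card (commutator (Hn n)) = 2 ^ (n ^ 2 * (n + 1) / 2) ∧
    (∀ g ∈ commutator (Hn n), g * g = 1) ∧
    (∀ g ∈ commutator (Hn n), ∀ h ∈ commutator (Hn n), g * h = h * g) ∧
    Nat.card (Wsub n) = 2 ^ n ^ 2 ∧
    (∀ g ∈ Wsub n, g * g = 1) ∧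
    Nat.card (Subgroup.lowerCentralSeries (⊤ : Subgroup (Hn n)) 2) = 2 ^ (n ^ 2 * (n - 1) / 2) ∧
    (∀ g ∈ Subgroup.lowerCentralSeries (⊤ : Subgroup (Hn n)) 2, g * g = 1) ∧
    Subgroup.lowerCentralSeries (⊤ : Subgroup (Hn n)) 2 ≤ Subgroup.center (Hn n) := by
  rw [← MG.range_t, MG.lcs_eq, MG.comm_eq, Wsub, ← MG.range_w]
  have hf := elem_ab MG.f MG.f_comm MG.f_sq _ MG.f_mem (MG.coord n) MG.coord_f
  have ht := elem_ab MG.t (fun p q => MG.t_comm p _) MG.t_sq _ MG.t_mem (MG.coordC n) MG.coordC_t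
  have hw := elem_ab MG.w MG.ww MG.wsq _ MG.w_mem (MG.coordB n) MG.coordB_w
  rw [MG.closure_f, MG.card_all] at hf
  rw [MG.card_S] at ht
  rw [Fintype.card_prod, Fintype.card_fin, ← pow_two] at hw
  exact ⟨rfl, rfl, MG.WT_inf, hf.1, hf.2.2.1, hf.2.1, hw.1, hw.2.2.1, ht.1, ht.2.2.1,
    MG.TT_center⟩
end
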